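/- Assume (A1), (A2), (A3) and the normalization ψ(ξ) = 1 for |ξ| = 1. Define p_t(x) = (2π)^{-d} ∫_{ℝ^d} e^{-iξ·x} e^{-tψ(ξ)} dξ for t ≥ t₀. Then there exist T₁ ≥ t₀ and C ≥ 1 such that for all t ≥ T₁: C^{-1} ψ^{-1}(1/t)^d ≤ p_t(0) ≤ C ψ^{-1}(1/t)^d, and for all x ∈ ℝ^d \ {0}: C^{-1}·min(p_t(0), t·ν(x)) ≤ p_t(x) ≤ C·min(p_t(0), t·ν(x)). -/

import Mathlib

open MeasureTheory Filter Real
open scoped RealInnerProductSpace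

noncomputable section

/-- Pruitt's concentration function `K(r) = r⁻² ∫_{|z|<r} |z|² ν(|z|) dz`. -/
def K (d : ℕ) (ν : ℝ → ℝ) (r : ℝ) : ℝ :=
  (∫ z in Metric.ball (0 : EuclideanSpace ℝ (Fin d)) r, ‖z‖ ^ 2 * ν ‖z‖) / r ^ 2

/-- Pruitt's concentration function `h(r) = ∫ (|z|²/r² ∧ 1) ν(|z|) dz`. -/
def hfun (d : ℕ) (ν : ℝ → ℝ) (r : ℝ) : ℝ :=
  ∫ z : EuclideanSpace ℝ (Fin d), min (‖z‖ ^ 2 / r ^ 2) 1 * ν ‖z‖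

/-- The characteristic (Lévy–Khintchine) exponent `ψ(ξ) = ∫ (1 - cos⟪ξ,z⟫) ν(|z|) dz`. -/
def ψ (d : ℕ) (ν : ℝ → ℝ) (ξ : EuclideanSpace ℝ (Fin d)) : ℝ :=
  ∫ z : EuclideanSpace ℝ (Fin d), (1 - Real.cos ⟪ξ, z⟫) * ν ‖z‖

/-- The radial nondecreasing majorant `ψ*(r) = sup_{|z| ≤ r} ψ(z)`. -/
def ψstar (d : ℕ) (ν : ℝ → ℝ) (r : ℝ) : ℝ :=
  sSup {y : ℝ | ∃ z : EuclideanSpace ℝ (Fin d), ‖z‖ ≤ r ∧ ψ d ν z = y}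

/-- The generalized inverse `ψ⁻¹(u) = sup {r ≥ 0 : ψ*(r) = u}`. -/
def ψinv (d : ℕ) (ν : ℝ → ℝ) (u : ℝ) : ℝ :=
  sSup {r : ℝ | 0 ≤ r ∧ ψstar d ν r = u}

/-- Characteristic exponent `ψˢ(ξ) = s·ψ(ψ⁻¹(1/s)ξ)` of the rescaled process. -/
def ψs (d : ℕ) (ν : ℝ → ℝ) (s : ℝ) (ξ : EuclideanSpace ℝ (Fin d)) : ℝ :=
  s * ψ d ν (ψinv d ν (1 / s) • ξ)

/-- Lévy density `νˢ(x) = s·ψ⁻¹(1/s)^{-d}·ν(x/ψ⁻¹(1/s))` of the rescaled process. -/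
def νs (d : ℕ) (ν : ℝ → ℝ) (s : ℝ) (x : EuclideanSpace ℝ (Fin d)) : ℝ :=
  s / ψinv d ν (1 / s) ^ d * ν (‖x‖ / ψinv d ν (1 / s))

/-- `ψ^{-1,s}(u) = ψ⁻¹(u/s)/ψ⁻¹(1/s)`. -/
def ψinvs (d : ℕ) (ν : ℝ → ℝ) (s u : ℝ) : ℝ :=
  ψinv d ν (u / s) / ψinv d ν (1 / s)

/-- The stable constant `𝒜(d,α)`. -/
def Aconst (d : ℕ) (α : ℝ) : ℝ :=
  α * (2 : ℝ) ^ (α - 1) * Real.Gamma (((d : ℝ) + α) / 2) /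
    (Real.Gamma (1 - α / 2) * Real.pi ^ ((d : ℝ) / 2))

/-- Heat kernel of the rescaled process, via Fourier inversion. -/
def pts (d : ℕ) (ν : ℝ → ℝ) (s t : ℝ) (x : EuclideanSpace ℝ (Fin d)) : ℝ :=
  ((2 * Real.pi) ^ d)⁻¹ *
    ∫ ξ : EuclideanSpace ℝ (Fin d), Real.cos ⟪ξ, x⟫ * Real.exp (-(t * ψs d ν s ξ))

/-- Heat kernel of the isotropic α-stable process. -/
def ptα (d : ℕ) (α t : ℝ) (x : EuclideanSpace ℝ (Fin d)) : ℝ :=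
  ((2 * Real.pi) ^ d)⁻¹ *
    ∫ ξ : EuclideanSpace ℝ (Fin d), Real.cos ⟪ξ, x⟫ * Real.exp (-(t * ‖ξ‖ ^ α))

/-- Heat kernel of the original process, via Fourier inversion. -/
def pt (d : ℕ) (ν : ℝ → ℝ) (t : ℝ) (x : EuclideanSpace ℝ (Fin d)) : ℝ :=
  ((2 * Real.pi) ^ d)⁻¹ *
    ∫ ξ : EuclideanSpace ℝ (Fin d), Real.cos ⟪ξ, x⟫ * Real.exp (-(t * ψ d ν ξ))

section CosineTransform

variable {V : Type*} [NormedAddCommGroup V] [InnerProductSpace ℝ V] [FiniteDimensional ℝ V]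
  [MeasurableSpace V] [BorelSpace V]

/-- The cosine transform `x ↦ ∫ cos⟪ξ,x⟫ φ(ξ) dξ`. -/
def cosTransform (φ : V → ℝ) (x : V) : ℝ := ∫ ξ, Real.cos ⟪ξ, x⟫ * φ ξ

/-- Nonnegative functions which are radial and radially non-increasing. -/
structure RadiallyDecreasing (F : V → ℝ) : Prop where
  nonneg : ∀ x, 0 ≤ F x
  anti : ∀ x y, ‖x‖ ≤ ‖y‖ → F y ≤ F x

/-- Integrable functions whose cosine transform is radially decreasing. -/
structure UnimodalTransform (φ : V → ℝ) : Prop where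
  integrable : Integrable φ
  radDec : RadiallyDecreasing (cosTransform φ)

omit [InnerProductSpace ℝ V] [FiniteDimensional ℝ V] [MeasurableSpace V] [BorelSpace V] in
lemma RadiallyDecreasing.congr_norm {F : V → ℝ} (hF : RadiallyDecreasing F) {x y : V}
    (h : ‖x‖ = ‖y‖) : F x = F y :=
  le_antisymm (hF.anti _ _ h.ge) (hF.anti _ _ h.le)

lemma integrable_cos_inner_mul {φ : V → ℝ} (hφ : Integrable φ) (x : V) :
    Integrable (fun ξ => Real.cos ⟪ξ, x⟫ * φ ξ) :=
  hφ.bdd_mul (c := 1) (by fun_prop) (ae_of_all _ fun ξ => by simpa using Real.abs_cos_le_one _)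

lemma integrable_sin_inner_mul {φ : V → ℝ} (hφ : Integrable φ) (x : V) :
    Integrable (fun ξ => Real.sin ⟪ξ, x⟫ * φ ξ) :=
  hφ.bdd_mul (c := 1) (by fun_prop) (ae_of_all _ fun ξ => by simpa using Real.abs_sin_le_one _)

lemma continuous_cosTransform {φ : V → ℝ} (hφ : Integrable φ) : Continuous (cosTransform φ) := by
  unfold cosTransform
  refine continuous_of_dominated (bound := fun ξ => ‖φ ξ‖)
    (fun x => (integrable_cos_inner_mul hφ x).aestronglyMeasurable)
    (fun x => ae_of_all _ fun ξ => ?_) hφ.norm (ae_of_all _ fun ξ => by fun_prop)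
  rw [norm_mul]
  exact mul_le_of_le_one_left (norm_nonneg _) (by simpa using Real.abs_cos_le_one _)

lemma abs_cosTransform_le {φ : V → ℝ} (hφ : Integrable φ) (x : V) :
    |cosTransform φ x| ≤ ∫ ξ, |φ ξ| := by
  refine (norm_integral_le_integral_norm _).trans
    (integral_mono (integrable_cos_inner_mul hφ x).norm hφ.abs fun ξ => ?_)
  simp only [norm_mul, Real.norm_eq_abs]
  exact mul_le_of_le_one_left (abs_nonneg _) (Real.abs_cos_le_one _)

omit [FiniteDimensional ℝ V] [MeasurableSpace V] [BorelSpace V] in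
/-- The reflection `z ↦ y + ρ(z - x)` in the bisector of `x` and `y` decreases (increases) the norm
on the side of `y` (of `x`), if `‖x‖ ≤ ‖y‖`. -/
lemma reflection_bisector (x y z : V) (hxy : ‖x‖ ≤ ‖y‖) (hne : x ≠ y) :
    ∃ w, w = y - (ℝ ∙ (x - y)).reflection (z - x) ∧
    ‖x - w‖ = ‖y - z‖ ∧ ‖y - w‖ = ‖x - z‖ ∧
    ((‖x - z‖ ≤ ‖y - z‖ ∧ ‖z‖ ≤ ‖w‖) ∨ (‖y - z‖ ≤ ‖x - z‖ ∧ ‖w‖ ≤ ‖z‖)) := by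
  refine ⟨_, rfl, ?_, ?_, ?_⟩
  · have h1 : (ℝ ∙ (x - y)).reflection (z - x) = (ℝ ∙ (x - y)).reflection (z - y) - (x - y) := by
      have : z - x = (z - y) - (x - y) := by abel
      conv_lhs => rw [this, map_sub]
      congr 1
      exact Submodule.reflection_mem_subspace_eq_self (Submodule.mem_span_singleton_self _)
    have : x - (y - (ℝ ∙ (x - y)).reflection (z - x)) = (ℝ ∙ (x - y)).reflection (z - y) := by
      rw [h1]; abel
    rw [this, LinearIsometryEquiv.norm_map, norm_sub_rev]
  · rw [sub_sub_cancel, LinearIsometryEquiv.norm_map, norm_sub_rev]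
  · set v := x - y with hv
    have hv0 : 0 < ‖v‖ ^ 2 := by
      have : v ≠ 0 := sub_ne_zero.2 hne
      positivity
    have hx : ‖x‖ ^ 2 = ‖y‖ ^ 2 + 2 * ⟪v, y⟫ + ‖v‖ ^ 2 := by
      have : x = v + y := by simp [hv]
      rw [this, norm_add_sq_real]; ring
    have he : ‖x‖ ^ 2 - ‖y‖ ^ 2 ≤ 0 := by
      have := pow_le_pow_left₀ (norm_nonneg x) hxy 2
      linarith
    have hvx : ⟪v, x⟫ = ⟪v, y⟫ + ‖v‖ ^ 2 := by
      have : x = y + v := by simp [hv]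
      rw [this, inner_add_right, real_inner_self_eq_norm_sq]
    set e := ‖x‖ ^ 2 - ‖y‖ ^ 2 with hedef
    set s : ℝ := ⟪v, z⟫ with hs
    have hw : y - (ℝ ∙ v).reflection (z - x) = z - ((2 * s - e) / ‖v‖ ^ 2) • v := by
      rw [Submodule.reflection_singleton_apply]
      simp only [RCLike.ofReal_real_eq_id, id]
      have h2 : (2 * s - e) / ‖v‖ ^ 2 = 2 * (⟪v, z - x⟫ / ‖v‖ ^ 2) + 1 := by
        have hq := hv0.ne'
        rw [inner_sub_right, hvx, ← hs, div_eq_iff hq, add_mul, mul_assoc, div_mul_cancel₀ _ hq]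
        linarith
      rw [h2, hv]
      module
    have hwn : ‖y - (ℝ ∙ v).reflection (z - x)‖ ^ 2 = ‖z‖ ^ 2 + (2 * s - e) * (-e) / ‖v‖ ^ 2 := by
      rw [hw, norm_sub_sq_real, inner_smul_right, norm_smul, mul_pow, Real.norm_eq_abs, sq_abs,
        real_inner_comm v z]
      rw [← hs]
      field_simp
      ring
    have hd : ‖x - z‖ ^ 2 - ‖y - z‖ ^ 2 = -(2 * s - e) := by
      rw [norm_sub_sq_real, norm_sub_sq_real]
      have : s = ⟪x, z⟫ - ⟪y, z⟫ := by rw [hs, hv, inner_sub_left]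
      rw [this]; ring
    rcases le_total e (2 * s) with h | h
    · left
      constructor
      · apply le_of_sq_le_sq _ (norm_nonneg _)
        linarith
      · apply le_of_sq_le_sq _ (norm_nonneg _)
        rw [hwn]
        have : 0 ≤ (2 * s - e) * (-e) / ‖v‖ ^ 2 :=
          div_nonneg (mul_nonneg (by linarith) (by linarith)) hv0.le
        linarith
    · right
      constructor
      · apply le_of_sq_le_sq _ (norm_nonneg _)
        linarith
      · apply le_of_sq_le_sq _ (norm_nonneg _)
        rw [hwn]
        have : 0 ≤ (e - 2 * s) * (-e) / ‖v‖ ^ 2 :=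
          div_nonneg (mul_nonneg (by linarith) (by linarith)) hv0.le
        have h3 : (2 * s - e) * (-e) / ‖v‖ ^ 2 = - ((e - 2 * s) * (-e) / ‖v‖ ^ 2) := by ring
        linarith

/-- The convolution of two radially decreasing functions is radially decreasing. -/
lemma RadiallyDecreasing.convolution {f g : V → ℝ} (hf : RadiallyDecreasing f)
    (hg : RadiallyDecreasing g) (hfi : Integrable f) (hgm : Measurable g) :
    RadiallyDecreasing (fun x => ∫ z, f z * g (x - z)) := by
  have hint : ∀ x, Integrable (fun z => f z * g (x - z)) := fun x =>
    hfi.mul_bdd (c := g 0) (hgm.comp (by fun_prop)).aestronglyMeasurable (ae_of_all _ fun z => by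
      rw [Real.norm_eq_abs, abs_of_nonneg (hg.nonneg _)]
      exact hg.anti _ _ (by simp))
  refine ⟨fun x => integral_nonneg fun z => mul_nonneg (hf.nonneg _) (hg.nonneg _),
    fun x y hxy => ?_⟩
  rcases eq_or_ne x y with rfl | hne
  · exact le_rfl
  set σ : V → V := fun z => y - (ℝ ∙ (x - y)).reflection (z - x) with hσ
  have hmp : MeasurePreserving σ := by
    have h1 : MeasurePreserving (fun z : V => z - x) := measurePreserving_sub_right volume x
    have h2 := ((ℝ ∙ (x - y)).reflection).measurePreserving
    have h3 : MeasurePreserving (fun z : V => y - z) := by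
      simpa only [sub_eq_add_neg, Function.comp_def] using
        (measurePreserving_add_left volume y).comp (Measure.measurePreserving_neg volume)
    exact h3.comp (h2.comp h1)
  have hme : MeasurableEmbedding σ := by
    have h1 : MeasurableEmbedding (fun z : V => z - x) := (MeasurableEquiv.subRight x).measurableEmbedding
    have h2 := ((ℝ ∙ (x - y)).reflection).toHomeomorph.measurableEmbedding
    have h3 : MeasurableEmbedding (fun z : V => y - z) := (MeasurableEquiv.subLeft y).measurableEmbedding
    exact h3.comp (h2.comp h1)
  have hσ1 : ∀ z, g (x - σ z) = g (y - z) := fun z => by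
    obtain ⟨w, rfl, h1, h2, -⟩ := reflection_bisector x y z hxy hne
    exact hg.congr_norm h1
  have hσ2 : ∀ z, g (y - σ z) = g (x - z) := fun z => by
    obtain ⟨w, rfl, h1, h2, -⟩ := reflection_bisector x y z hxy hne
    exact hg.congr_norm h2
  have hpos : ∀ z, 0 ≤ (f z - f (σ z)) * (g (x - z) - g (y - z)) := fun z => by
    obtain ⟨w, hw, -, -, h⟩ := reflection_bisector x y z hxy hne
    have hw' : σ z = w := hw.symm
    rw [hw']
    rcases h with ⟨h1, h2⟩ | ⟨h1, h2⟩
    · exact mul_nonneg (sub_nonneg.2 (hf.anti _ _ h2)) (sub_nonneg.2 (hg.anti _ _ h1))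
    · exact mul_nonneg_of_nonpos_of_nonpos (sub_nonpos.2 (hf.anti _ _ h2))
        (sub_nonpos.2 (hg.anti _ _ h1))
  have hI : Integrable (fun z => f z * g (x - z) - f z * g (y - z)) := (hint x).sub (hint y)
  have hI2 : Integrable (fun z => f (σ z) * g (y - σ z) - f (σ z) * g (x - σ z)) :=
    hmp.integrable_comp_emb hme |>.2 ((hint y).sub (hint x))
  have e1 : ∫ z, (f (σ z) * g (y - σ z) - f (σ z) * g (x - σ z))
      = ∫ z, (f z * g (y - z) - f z * g (x - z)) :=
    hmp.integral_comp hme (fun z => f z * g (y - z) - f z * g (x - z))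
  have e2 : 0 ≤ ∫ z, (f z - f (σ z)) * (g (x - z) - g (y - z)) := integral_nonneg hpos
  have e3 : ∫ z, (f z - f (σ z)) * (g (x - z) - g (y - z)) =
      (∫ z, (f z * g (x - z) - f z * g (y - z))) -
        ∫ z, (f (σ z) * g (y - σ z) - f (σ z) * g (x - σ z)) := by
    rw [← integral_sub hI hI2]
    congr 1
    ext z
    rw [hσ1, hσ2]
    ring
  rw [e3, e1, integral_sub (hint x) (hint y), integral_sub (hint y) (hint x)] at e2
  show ∫ z, f z * g (y - z) ≤ ∫ z, f z * g (x - z)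
  linarith

lemma cosTransform_mul_cosTransform {φ f : V → ℝ} (hφ : Integrable φ) (hf : Integrable f)
    (heven : ∀ z, f (-z) = f z) (x : V) :
    cosTransform (fun ξ => cosTransform f ξ * φ ξ) x = ∫ z, f z * cosTransform φ (x - z) := by
  have h1 : ∀ ξ : V, Real.cos ⟪ξ, x⟫ * (cosTransform f ξ * φ ξ)
      = ∫ z, f z * (Real.cos ⟪ξ, x - z⟫ * φ ξ) := by
    intro ξ
    have hsin : ∫ z, Real.sin ⟪z, ξ⟫ * f z = 0 := by
      have := integral_neg_eq_self (fun z => Real.sin ⟪z, ξ⟫ * f z) (volume : Measure V)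
      simp only [inner_neg_left, Real.sin_neg, heven, neg_mul, integral_neg] at this
      linarith
    have : ∀ z, f z * (Real.cos ⟪ξ, x - z⟫ * φ ξ) =
        (Real.cos ⟪ξ, x⟫ * φ ξ) * (Real.cos ⟪z, ξ⟫ * f z) +
        (Real.sin ⟪ξ, x⟫ * φ ξ) * (Real.sin ⟪z, ξ⟫ * f z) := by
      intro z
      rw [inner_sub_right, Real.cos_sub, real_inner_comm z ξ]
      ring
    simp_rw [this]
    rw [integral_add ((integrable_cos_inner_mul hf ξ).const_mul _)
      ((integrable_sin_inner_mul hf ξ).const_mul _), integral_const_mul, integral_const_mul, hsin,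
      cosTransform]
    ring
  have h2 : Integrable (Function.uncurry fun ξ z : V => f z * (Real.cos ⟪ξ, x - z⟫ * φ ξ))
      (volume.prod volume) := by
    have := (hφ.mul_prod hf).bdd_mul (c := 1)
      (f := fun p : V × V => Real.cos ⟪p.1, x - p.2⟫) (by fun_prop)
      (ae_of_all _ fun ξ => by simpa using Real.abs_cos_le_one _)
    refine this.congr (ae_of_all _ fun p => ?_)
    simp only [Function.uncurry]
    ring
  unfold cosTransform at h1 ⊢
  simp_rw [h1]
  rw [integral_integral_swap h2]
  simp_rw [integral_const_mul]

lemma UnimodalTransform.mul_const_add_cosTransform {φ f : V → ℝ} (hφ : UnimodalTransform φ)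
    (hf : RadiallyDecreasing f) (hfi : Integrable f) {a b : ℝ} (ha : 0 ≤ a) (hb : 0 ≤ b) :
    UnimodalTransform (fun ξ => (a + b * cosTransform f ξ) * φ ξ) := by
  have hm : Measurable (cosTransform φ) := (continuous_cosTransform hφ.integrable).measurable
  have hconv := hf.convolution hφ.radDec hfi hm
  have hi : Integrable (fun ξ => cosTransform f ξ * φ ξ) :=
    hφ.integrable.bdd_mul (c := ∫ ξ, |f ξ|) (continuous_cosTransform hfi).aestronglyMeasurable
      (ae_of_all _ fun ξ => abs_cosTransform_le hfi ξ)
  have hsum : ∀ ξ, (a + b * cosTransform f ξ) * φ ξ = a * φ ξ + b * (cosTransform f ξ * φ ξ) :=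
    fun ξ => by ring
  have hT : cosTransform (fun ξ => (a + b * cosTransform f ξ) * φ ξ) =
      fun x => a * cosTransform φ x + b * ∫ z, f z * cosTransform φ (x - z) := by
    ext x
    rw [← cosTransform_mul_cosTransform hφ.integrable hfi
      (fun z => hf.congr_norm (norm_neg z)) x]
    unfold cosTransform at hsum hi ⊢
    simp_rw [hsum, mul_add, mul_left_comm _ a, mul_left_comm _ b]
    rw [integral_add ((integrable_cos_inner_mul hφ.integrable x).const_mul a)
      ((integrable_cos_inner_mul hi x).const_mul b), integral_const_mul, integral_const_mul]
  refine ⟨?_, ?_⟩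
  · simp_rw [hsum]
    exact (hφ.integrable.const_mul a).add (hi.const_mul b)
  · rw [hT]
    refine ⟨fun x => add_nonneg (mul_nonneg ha (hφ.radDec.nonneg x))
      (mul_nonneg hb (hconv.nonneg x)), fun x y hxy => ?_⟩
    exact add_le_add (mul_le_mul_of_nonneg_left (hφ.radDec.anti x y hxy) ha)
      (mul_le_mul_of_nonneg_left (hconv.anti x y hxy) hb)

lemma UnimodalTransform.of_tendsto {φ : V → ℝ} {Φ : ℕ → V → ℝ} {bound : V → ℝ}
    (hΦ : ∀ᶠ n in atTop, UnimodalTransform (Φ n)) (hb : Integrable bound)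
    (hle : ∀ᶠ n in atTop, ∀ ξ, |Φ n ξ| ≤ bound ξ)
    (hlim : ∀ᵐ ξ, Tendsto (fun n => Φ n ξ) atTop (nhds (φ ξ))) : UnimodalTransform φ := by
  have hT : ∀ x, Tendsto (fun n => cosTransform (Φ n) x) atTop (nhds (cosTransform φ x)) := by
    intro x
    refine tendsto_integral_filter_of_dominated_convergence bound ?_ ?_ hb ?_
    · filter_upwards [hΦ] with n hn
      exact (integrable_cos_inner_mul hn.integrable x).aestronglyMeasurable
    · filter_upwards [hle] with n hn
      refine ae_of_all _ fun ξ => ?_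
      rw [norm_mul]
      exact (mul_le_of_le_one_left (norm_nonneg _)
        (by simpa using Real.abs_cos_le_one _)).trans (hn ξ)
    · filter_upwards [hlim] with ξ h
      exact h.const_mul _
  have hm : AEStronglyMeasurable φ := by
    obtain ⟨N, hN⟩ := eventually_atTop.1 hΦ
    refine aestronglyMeasurable_of_tendsto_ae (u := atTop) (f := fun n => Φ (n + N))
      (fun n => (hN _ (by omega)).integrable.aestronglyMeasurable) ?_
    filter_upwards [hlim] with ξ h
    exact h.comp (tendsto_add_atTop_nat N)
  refine ⟨hb.mono' hm ?_, ⟨fun x => ?_, fun x y hxy => ?_⟩⟩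
  · filter_upwards [hlim] with ξ h
    exact le_of_tendsto h.abs (hle.mono fun n hn => hn ξ)
  · exact ge_of_tendsto (hT x) (hΦ.mono fun n hn => hn.radDec.nonneg x)
  · exact le_of_tendsto_of_tendsto (hT y) (hT x) (hΦ.mono fun n hn => hn.radDec.anti x y hxy)

lemma integrable_exp_neg_mul_norm_sq {ε : ℝ} (hε : 0 < ε) :
    Integrable (fun ξ : V => Real.exp (-ε * ‖ξ‖ ^ 2)) := by
  have h := GaussianFourier.integrable_cexp_neg_mul_sq_norm_add (V := V) (b := (ε : ℂ))
    (by simpa using hε) 0 0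
  refine h.re.congr (ae_of_all _ fun ξ => ?_)
  have : (-(ε : ℂ) * (‖ξ‖ : ℂ) ^ 2 + 0 * ((inner ℝ (0 : V) ξ : ℝ) : ℂ)) =
    ((-ε * ‖ξ‖ ^ 2 : ℝ) : ℂ) := by push_cast; ring
  simp only [RCLike.re_to_complex]
  rw [this, ← Complex.ofReal_exp, Complex.ofReal_re]

lemma cosTransform_gaussian {ε : ℝ} (hε : 0 < ε) (x : V) :
    cosTransform (fun ξ : V => Real.exp (-ε * ‖ξ‖ ^ 2)) x =
      (Real.pi / ε) ^ ((Module.finrank ℝ V : ℝ) / 2) * Real.exp (-(‖x‖ ^ 2 / (4 * ε))) := by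
  have h := GaussianFourier.integral_cexp_neg_mul_sq_norm_add (V := V) (b := (ε : ℂ))
    (by simpa using hε) Complex.I x
  have hi := GaussianFourier.integrable_cexp_neg_mul_sq_norm_add (V := V) (b := (ε : ℂ))
    (by simpa using hε) Complex.I x
  have h2 := congrArg Complex.re h
  rw [← RCLike.re_to_complex, ← integral_re hi] at h2
  have e1 : ∀ ξ : V, RCLike.re (Complex.exp (-(ε : ℂ) * (‖ξ‖ : ℂ) ^ 2 + Complex.I *
      ((inner ℝ x ξ : ℝ) : ℂ))) = Real.cos ⟪ξ, x⟫ * Real.exp (-ε * ‖ξ‖ ^ 2) := by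
    intro ξ
    rw [RCLike.re_to_complex, Complex.exp_re, real_inner_comm]
    simp [← Complex.ofReal_pow]
    ring
  simp_rw [e1] at h2
  rw [cosTransform, h2]
  have e2 : Complex.I ^ 2 * (‖x‖ : ℂ) ^ 2 / (4 * (ε : ℂ)) = ((-(‖x‖ ^ 2 / (4 * ε)) : ℝ) : ℂ) := by
    rw [Complex.I_sq]; push_cast; ring
  have e3 : ((Real.pi : ℂ) / (ε : ℂ)) ^ ((Module.finrank ℝ V : ℂ) / 2) =
      (((Real.pi / ε) ^ ((Module.finrank ℝ V : ℝ) / 2) : ℝ) : ℂ) := by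
    rw [Complex.ofReal_cpow (by positivity)]
    push_cast
    rfl
  rw [e2, e3, ← Complex.ofReal_exp, ← Complex.ofReal_mul, Complex.ofReal_re]

lemma unimodalTransform_gaussian {ε : ℝ} (hε : 0 < ε) :
    UnimodalTransform (fun ξ : V => Real.exp (-ε * ‖ξ‖ ^ 2)) := by
  refine ⟨integrable_exp_neg_mul_norm_sq hε, ⟨fun x => ?_, fun x y hxy => ?_⟩⟩
  · rw [cosTransform_gaussian hε]; positivity
  · rw [cosTransform_gaussian hε, cosTransform_gaussian hε]
    gcongr

end CosineTransform

/-- The standing assumptions on a radially non-increasing Lévy density. -/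
structure IsUnimodalLevyDensity (d : ℕ) (ν : ℝ → ℝ) : Prop where
  dim_pos : 1 ≤ d
  pos : ∀ r : ℝ, 0 < r → 0 < ν r
  anti : ∀ r₁ r₂ : ℝ, 0 < r₁ → r₁ ≤ r₂ → ν r₂ ≤ ν r₁
  integrable : Integrable (fun z : EuclideanSpace ℝ (Fin d) => min (‖z‖ ^ 2) 1 * ν ‖z‖)

lemma one_sub_cos_nonneg (x : ℝ) : 0 ≤ 1 - Real.cos x := sub_nonneg.2 (Real.cos_le_one x)

lemma one_sub_cos_inner_le {V : Type*} [NormedAddCommGroup V] [InnerProductSpace ℝ V]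
    {r : ℝ} (hr : 0 < r) (ξ z : V) :
    1 - Real.cos ⟪ξ, z⟫ ≤ 2 * (1 + r ^ 2 * ‖ξ‖ ^ 2) * min (‖z‖ ^ 2 / r ^ 2) 1 := by
  have h1 : 1 - Real.cos ⟪ξ, z⟫ ≤ 2 := by linarith [Real.neg_one_le_cos ⟪ξ, z⟫]
  have h2 : 1 - Real.cos ⟪ξ, z⟫ ≤ ‖ξ‖ ^ 2 * ‖z‖ ^ 2 := by
    have h3 := Real.one_sub_sq_div_two_le_cos (x := ⟪ξ, z⟫)
    have h4 : ⟪ξ, z⟫ ^ 2 ≤ ‖ξ‖ ^ 2 * ‖z‖ ^ 2 := by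
      rw [← mul_pow, ← sq_abs]
      exact pow_le_pow_left₀ (abs_nonneg _) (abs_real_inner_le_norm ξ z) 2
    have h5 : 0 ≤ ‖ξ‖ ^ 2 * ‖z‖ ^ 2 := by positivity
    linarith
  have h6 : 0 ≤ r ^ 2 * ‖ξ‖ ^ 2 := by positivity
  rcases min_cases (‖z‖ ^ 2 / r ^ 2) 1 with ⟨h, -⟩ | ⟨h, -⟩
  · rw [h]
    have h7 : ‖ξ‖ ^ 2 * ‖z‖ ^ 2 = r ^ 2 * ‖ξ‖ ^ 2 * (‖z‖ ^ 2 / r ^ 2) := by field_simp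
    have h8 : 0 ≤ ‖z‖ ^ 2 / r ^ 2 := by positivity
    rw [h7] at h2
    nlinarith
  · rw [h]; linarith

namespace IsUnimodalLevyDensity

variable {d : ℕ} {ν : ℝ → ℝ}

lemma nontrivial (h : IsUnimodalLevyDensity d ν) : Nontrivial (EuclideanSpace ℝ (Fin d)) := by
  have : Nonempty (Fin d) := ⟨⟨0, h.dim_pos⟩⟩
  infer_instance

lemma ae_ne_zero (h : IsUnimodalLevyDensity d ν) : ∀ᵐ z : EuclideanSpace ℝ (Fin d), z ≠ 0 := by
  have := h.nontrivial
  exact Measure.ae_ne volume 0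

lemma aestronglyMeasurable (h : IsUnimodalLevyDensity d ν) :
    AEStronglyMeasurable (fun z : EuclideanSpace ℝ (Fin d) => ν ‖z‖) := by
  have hm : Measurable (fun z : EuclideanSpace ℝ (Fin d) => (min (‖z‖ ^ 2) 1)⁻¹) := by fun_prop
  refine (hm.aestronglyMeasurable.mul h.integrable.aestronglyMeasurable).congr ?_
  filter_upwards [h.ae_ne_zero] with z hz
  have : 0 < min (‖z‖ ^ 2) 1 := lt_min (by positivity) one_pos
  simp only [Pi.mul_apply]
  field_simp

lemma integrable_min_div (h : IsUnimodalLevyDensity d ν) {r : ℝ} (hr : 0 < r) :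
    Integrable (fun z : EuclideanSpace ℝ (Fin d) => min (‖z‖ ^ 2 / r ^ 2) 1 * ν ‖z‖) := by
  refine (h.integrable.norm.const_mul (1 + 1 / r ^ 2)).mono'
    (AEStronglyMeasurable.mul (by fun_prop) h.aestronglyMeasurable) (ae_of_all _ fun z => ?_)
  have h0 : 0 ≤ min (‖z‖ ^ 2) 1 := le_min (by positivity) zero_le_one
  have h1 : 0 ≤ min (‖z‖ ^ 2 / r ^ 2) 1 := le_min (by positivity) zero_le_one
  have h2 : 0 < 1 / r ^ 2 := by positivity
  rw [norm_mul, norm_mul, Real.norm_of_nonneg h0, Real.norm_of_nonneg h1, ← mul_assoc]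
  refine mul_le_mul_of_nonneg_right ?_ (norm_nonneg _)
  rcases min_cases (‖z‖ ^ 2) 1 with ⟨h3, -⟩ | ⟨h3, -⟩
  · rw [h3]
    refine (min_le_left _ _).trans ?_
    rw [div_eq_mul_one_div]
    nlinarith [sq_nonneg ‖z‖]
  · rw [h3]
    refine (min_le_right _ _).trans ?_
    linarith

lemma integrable_one_sub_cos (h : IsUnimodalLevyDensity d ν) (ξ : EuclideanSpace ℝ (Fin d)) :
    Integrable (fun z : EuclideanSpace ℝ (Fin d) => (1 - Real.cos ⟪ξ, z⟫) * ν ‖z‖) := by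
  refine ((h.integrable_min_div one_pos).norm.const_mul (2 * (1 + 1 ^ 2 * ‖ξ‖ ^ 2))).mono'
    (AEStronglyMeasurable.mul (by fun_prop) h.aestronglyMeasurable) (ae_of_all _ fun z => ?_)
  rw [norm_mul, norm_mul, Real.norm_of_nonneg (one_sub_cos_nonneg _), ← mul_assoc,
    Real.norm_of_nonneg (le_min (by positivity) zero_le_one)]
  exact mul_le_mul_of_nonneg_right (one_sub_cos_inner_le one_pos ξ z) (norm_nonneg _)

lemma continuous_psi (h : IsUnimodalLevyDensity d ν) : Continuous (ψ d ν) := by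
  rw [continuous_iff_continuousAt]
  intro ξ₀
  refine continuousAt_of_dominated (bound := fun z => 2 * (1 + 1 ^ 2 * (‖ξ₀‖ + 1) ^ 2) *
    ‖min (‖z‖ ^ 2 / 1 ^ 2) 1 * ν ‖z‖‖)
    (Eventually.of_forall fun ξ => (h.integrable_one_sub_cos ξ).aestronglyMeasurable) ?_
    ((h.integrable_min_div one_pos).norm.const_mul _) (ae_of_all _ fun z => by fun_prop)
  filter_upwards [Metric.ball_mem_nhds ξ₀ one_pos] with ξ hξ
  refine ae_of_all _ fun z => ?_
  have hξ' : ‖ξ‖ ≤ ‖ξ₀‖ + 1 := by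
    have h1 := norm_le_norm_add_norm_sub' ξ ξ₀
    rw [mem_ball_iff_norm] at hξ
    linarith
  rw [norm_mul, norm_mul, Real.norm_of_nonneg (one_sub_cos_nonneg _), ← mul_assoc,
    Real.norm_of_nonneg (le_min (by positivity) zero_le_one)]
  refine mul_le_mul_of_nonneg_right ((one_sub_cos_inner_le one_pos ξ z).trans ?_) (norm_nonneg _)
  have : 0 ≤ min (‖z‖ ^ 2 / 1 ^ 2) 1 := le_min (by positivity) zero_le_one
  gcongr

lemma psi_nonneg (h : IsUnimodalLevyDensity d ν) (ξ : EuclideanSpace ℝ (Fin d)) :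
    0 ≤ ψ d ν ξ := by
  refine integral_nonneg_of_ae ?_
  filter_upwards [h.ae_ne_zero] with z hz
  exact mul_nonneg (one_sub_cos_nonneg _) (h.pos _ (norm_pos_iff.2 hz)).le

/-- The bounded radially decreasing function `ν ∧ n`. -/
def truncation (d : ℕ) (ν : ℝ → ℝ) (n : ℕ) (z : EuclideanSpace ℝ (Fin d)) : ℝ :=
  open Classical in if z = 0 then n else min (ν ‖z‖) n

lemma radiallyDecreasing_truncation (h : IsUnimodalLevyDensity d ν) (n : ℕ) :
    RadiallyDecreasing (truncation d ν n) := by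
  refine ⟨fun z => ?_, fun x y hxy => ?_⟩
  · unfold truncation
    split_ifs with hz
    · positivity
    · exact le_min (h.pos _ (norm_pos_iff.2 hz)).le (by positivity)
  · unfold truncation
    split_ifs with hy hx hx
    · exact le_rfl
    · subst hy
      exact absurd (norm_le_zero_iff.1 (by simpa using hxy)) hx
    · exact min_le_right _ _
    · exact min_le_min_right _ (h.anti _ _ (norm_pos_iff.2 hx) hxy)

lemma truncation_ae_eq (h : IsUnimodalLevyDensity d ν) (n : ℕ) :
    truncation d ν n =ᵐ[volume] fun z => min (ν ‖z‖) n := by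
  filter_upwards [h.ae_ne_zero] with z hz
  simp [truncation, hz]

lemma aestronglyMeasurable_truncation (h : IsUnimodalLevyDensity d ν) (n : ℕ) :
    AEStronglyMeasurable (truncation d ν n) :=
  (h.aestronglyMeasurable.inf aestronglyMeasurable_const).congr (h.truncation_ae_eq n).symm

lemma integrable_truncation (h : IsUnimodalLevyDensity d ν) (n : ℕ) :
    Integrable (truncation d ν n) := by
  have hb : Integrable ((Metric.ball (0 : EuclideanSpace ℝ (Fin d)) 1).indicator
      (fun _ => (n : ℝ))) :=
    (integrable_indicator_iff measurableSet_ball).2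
      (integrableOn_const (measure_ball_lt_top.ne))
  refine (hb.add h.integrable.norm).mono' (h.aestronglyMeasurable_truncation n) ?_
  filter_upwards [h.ae_ne_zero, h.truncation_ae_eq n] with z hz he
  rw [Real.norm_of_nonneg ((h.radiallyDecreasing_truncation n).nonneg z), he]
  simp only [Pi.add_apply]
  by_cases hz1 : ‖z‖ < 1
  · rw [Set.indicator_of_mem (by simpa using hz1)]
    have := norm_nonneg (min (‖z‖ ^ 2) 1 * ν ‖z‖)
    have := min_le_right (ν ‖z‖) (n : ℝ)
    linarith
  · rw [Set.indicator_of_notMem (by simpa using hz1), zero_add]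
    have h1 : 1 ≤ ‖z‖ ^ 2 := one_le_pow₀ (not_lt.1 hz1)
    rw [min_eq_right h1, one_mul]
    exact (min_le_left _ _).trans (le_abs_self _)

lemma tendsto_truncation (z : EuclideanSpace ℝ (Fin d)) (hz : z ≠ 0) :
    Tendsto (fun n => truncation d ν n z) atTop (nhds (ν ‖z‖)) := by
  obtain ⟨N, hN⟩ := exists_nat_ge (ν ‖z‖)
  refine tendsto_const_nhds.congr' ?_
  filter_upwards [eventually_ge_atTop N] with n hn
  have : (N : ℝ) ≤ n := by exact_mod_cast hn
  simp [truncation, hz, hN.trans this]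

lemma tendsto_integral_sub_cosTransform_truncation (h : IsUnimodalLevyDensity d ν)
    (ξ : EuclideanSpace ℝ (Fin d)) :
    Tendsto (fun n => (∫ z, truncation d ν n z) - cosTransform (truncation d ν n) ξ) atTop
      (nhds (ψ d ν ξ)) := by
  have h1 : ∀ n, (∫ z, truncation d ν n z) - cosTransform (truncation d ν n) ξ =
      ∫ z, (1 - Real.cos ⟪ξ, z⟫) * truncation d ν n z := by
    intro n
    rw [cosTransform, ← integral_sub (h.integrable_truncation n)
      (integrable_cos_inner_mul (h.integrable_truncation n) ξ)]
    congr 1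
    ext z
    rw [real_inner_comm]
    ring
  simp_rw [h1]
  refine tendsto_integral_of_dominated_convergence
    (fun z => ‖(1 - Real.cos ⟪ξ, z⟫) * ν ‖z‖‖)
    (fun n => AEStronglyMeasurable.mul (by fun_prop) (h.aestronglyMeasurable_truncation n))
    (h.integrable_one_sub_cos ξ).norm (fun n => ?_) ?_
  · filter_upwards [h.ae_ne_zero, h.truncation_ae_eq n] with z hz he
    rw [norm_mul, norm_mul, Real.norm_of_nonneg ((h.radiallyDecreasing_truncation n).nonneg z), he]
    exact mul_le_mul_of_nonneg_left ((min_le_left _ _).trans (le_abs_self _)) (norm_nonneg _)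
  · filter_upwards [h.ae_ne_zero] with z hz
    exact (tendsto_truncation z hz).const_mul _

end IsUnimodalLevyDensity

lemma UnimodalTransform.mul_exp_cosTransform_sub {V : Type*} [NormedAddCommGroup V]
    [InnerProductSpace ℝ V] [FiniteDimensional ℝ V] [MeasurableSpace V] [BorelSpace V]
    {φ f : V → ℝ} (hφ : UnimodalTransform φ) (hf : RadiallyDecreasing f) (hfi : Integrable f)
    {t : ℝ} (ht : 0 ≤ t) :
    UnimodalTransform (fun ξ => Real.exp (-(t * ((∫ z, f z) - cosTransform f ξ))) * φ ξ) := by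
  have habs : ∀ ξ, |cosTransform f ξ| ≤ ∫ z, f z := fun ξ => by
    refine (abs_cosTransform_le hfi ξ).trans (le_of_eq ?_)
    congr 1
    ext z
    exact abs_of_nonneg (hf.nonneg z)
  set m := ∫ z, f z with hm
  have hm0 : 0 ≤ m := integral_nonneg hf.nonneg
  have hpow : ∀ a b : ℝ, 0 ≤ a → 0 ≤ b → ∀ k : ℕ,
      UnimodalTransform (fun ξ => (a + b * cosTransform f ξ) ^ k * φ ξ) := by
    intro a b ha hb k
    induction k with
    | zero => simpa using hφ
    | succ k ih =>
      have := ih.mul_const_add_cosTransform hf hfi ha hb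
      simpa only [pow_succ', mul_assoc] using this
  have hN : ∀ᶠ N : ℕ in atTop, 0 < (N : ℝ) ∧ t * m / N ≤ 1 := by
    obtain ⟨N₀, hN₀⟩ := exists_nat_ge (t * m)
    filter_upwards [eventually_ge_atTop N₀, eventually_gt_atTop 0] with N h1 h2
    have h3 : (0 : ℝ) < N := by exact_mod_cast h2
    have h4 : (N₀ : ℝ) ≤ N := by exact_mod_cast h1
    exact ⟨h3, (div_le_one h3).2 (hN₀.trans h4)⟩
  have hbase : ∀ (N : ℕ) (ξ : V), 1 + -(t * (m - cosTransform f ξ)) / N =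
      (1 - t * m / N) + t / N * cosTransform f ξ := fun N ξ => by ring
  refine UnimodalTransform.of_tendsto
    (Φ := fun N ξ => (1 + -(t * (m - cosTransform f ξ)) / N) ^ N * φ ξ) (bound := fun ξ => |φ ξ|)
    ?_ hφ.integrable.abs ?_ (ae_of_all _ fun ξ => ?_)
  · filter_upwards [hN] with N ⟨h1, h2⟩
    simp_rw [hbase]
    exact hpow _ _ (by linarith) (by positivity) N
  · filter_upwards [hN] with N ⟨h1, h2⟩ ξ
    rw [abs_mul, abs_pow, hbase]
    refine mul_le_of_le_one_left (abs_nonneg _) (pow_le_one₀ (abs_nonneg _) ?_)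
    have h3 := abs_le.1 (habs ξ)
    have h4 : 0 ≤ t / N := by positivity
    have h5 : t * m / N = t / N * m := by ring
    rw [h5] at h2 ⊢
    have h6 := mul_le_mul_of_nonneg_left h3.1 h4
    have h7 := mul_le_mul_of_nonneg_left h3.2 h4
    rw [abs_le]
    constructor <;> linarith
  · exact (Real.tendsto_one_add_div_pow_exp _).mul_const _

lemma IsUnimodalLevyDensity.unimodalTransform_exp_neg {d : ℕ} {ν : ℝ → ℝ}
    (h : IsUnimodalLevyDensity d ν) {t : ℝ} (ht : 0 ≤ t)
    (hi : Integrable (fun ξ : EuclideanSpace ℝ (Fin d) => Real.exp (-(t * ψ d ν ξ)))) :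
    UnimodalTransform (fun ξ : EuclideanSpace ℝ (Fin d) => Real.exp (-(t * ψ d ν ξ))) := by
  have habs : ∀ n ξ, 0 ≤ (∫ z, truncation d ν n z) - cosTransform (truncation d ν n) ξ := by
    intro n ξ
    have h1 := abs_cosTransform_le (h.integrable_truncation n) ξ
    have h2 : ∫ z, |truncation d ν n z| = ∫ z, truncation d ν n z := by
      congr 1
      ext z
      exact abs_of_nonneg ((h.radiallyDecreasing_truncation n).nonneg z)
    rw [h2] at h1
    linarith [le_abs_self (cosTransform (truncation d ν n) ξ)]
  have hε : ∀ ε : ℝ, 0 < ε → UnimodalTransform (fun ξ : EuclideanSpace ℝ (Fin d) =>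
      Real.exp (-(t * ψ d ν ξ)) * Real.exp (-ε * ‖ξ‖ ^ 2)) := by
    intro ε hε
    refine UnimodalTransform.of_tendsto (Φ := fun n ξ => Real.exp (-(t * ((∫ z, truncation d ν n z)
        - cosTransform (truncation d ν n) ξ))) * Real.exp (-ε * ‖ξ‖ ^ 2))
      (Eventually.of_forall fun n => (unimodalTransform_gaussian hε).mul_exp_cosTransform_sub
        (h.radiallyDecreasing_truncation n) (h.integrable_truncation n) ht)
      (integrable_exp_neg_mul_norm_sq hε) (Eventually.of_forall fun n ξ => ?_)
      (ae_of_all _ fun ξ => ?_)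
    · rw [abs_of_nonneg (by positivity)]
      refine mul_le_of_le_one_left (Real.exp_pos _).le (Real.exp_le_one_iff.2 ?_)
      have := mul_nonneg ht (habs n ξ)
      linarith
    · refine Tendsto.mul_const _ ((Real.continuous_exp.tendsto _).comp ?_)
      exact ((h.tendsto_integral_sub_cosTransform_truncation ξ).const_mul t).neg
  refine UnimodalTransform.of_tendsto (Φ := fun n ξ => Real.exp (-(t * ψ d ν ξ)) *
      Real.exp (-(1 / ((n : ℝ) + 1)) * ‖ξ‖ ^ 2))
    (Eventually.of_forall fun n => hε _ (by positivity)) hi (Eventually.of_forall fun n ξ => ?_)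
    (ae_of_all _ fun ξ => ?_)
  · rw [abs_of_nonneg (by positivity)]
    refine mul_le_of_le_one_right (Real.exp_pos _).le (Real.exp_le_one_iff.2 ?_)
    have : 0 ≤ 1 / ((n : ℝ) + 1) * ‖ξ‖ ^ 2 := by positivity
    linarith
  · have h1 : Tendsto (fun n : ℕ => Real.exp (-(1 / ((n : ℝ) + 1)) * ‖ξ‖ ^ 2)) atTop (nhds 1) := by
      have h2 : Tendsto (fun n : ℕ => -(1 / ((n : ℝ) + 1)) * ‖ξ‖ ^ 2) atTop (nhds 0) := by
        simpa using (tendsto_one_div_add_atTop_nhds_zero_nat (𝕜 := ℝ)).neg.mul_const (‖ξ‖ ^ 2)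
      simpa [Function.comp_def] using (Real.continuous_exp.tendsto _).comp h2
    simpa using h1.const_mul (Real.exp (-(t * ψ d ν ξ)))

/-- Unimodal Lévy densities with global lower scaling and upper scaling at infinity. -/
structure IsScalingLevyDensity (d : ℕ) (ν : ℝ → ℝ) (β M γ r₀ C : ℝ) : Prop extends
    IsUnimodalLevyDensity d ν where
  beta_pos : 0 < β
  beta_lt : β < 2
  one_le_M : 1 ≤ M
  gamma_pos : 0 < γ
  one_le_r₀ : 1 ≤ r₀
  one_le_C : 1 ≤ C
  lower : ∀ s r : ℝ, 0 < s → s ≤ r → ν s ≤ M * (r / s) ^ ((d : ℝ) + β) * ν r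
  upper : ∀ s r : ℝ, r₀ ≤ s → s ≤ r → ν r ≤ C * (s / r) ^ ((d : ℝ) + γ) * ν s

lemma exists_upper_scaling_of_tendsto {ν : ℝ → ℝ} (hpos : ∀ r : ℝ, 0 < r → 0 < ν r)
    (hanti : ∀ r₁ r₂ : ℝ, 0 < r₁ → r₁ ≤ r₂ → ν r₂ ≤ ν r₁) {p q : ℝ} (hq : 0 < q) (hpq : q < p)
    (hlim : Tendsto (fun r : ℝ => ν (2 * r) / ν r) atTop (nhds ((2 : ℝ) ^ (-p)))) :
    ∃ r₀ : ℝ, 1 ≤ r₀ ∧ ∀ s r : ℝ, r₀ ≤ s → s ≤ r → ν r ≤ (2 : ℝ) ^ q * (s / r) ^ q * ν s := by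
  have hlt : (2 : ℝ) ^ (-p) < (2 : ℝ) ^ (-q) :=
    Real.rpow_lt_rpow_of_exponent_lt one_lt_two (by linarith)
  obtain ⟨R, hR⟩ := eventually_atTop.1 (hlim.eventually_lt_const hlt)
  refine ⟨max R 1, le_max_right _ _, fun s r hs hsr => ?_⟩
  have hs0 : 0 < s := lt_of_lt_of_le one_pos ((le_max_right _ _).trans hs)
  have hr0 : 0 < r := hs0.trans_le hsr
  have hiter : ∀ k : ℕ, ν (2 ^ k * s) ≤ ((2 : ℝ) ^ (-q)) ^ k * ν s := by
    intro k
    induction k with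
    | zero => simp
    | succ k ih =>
      have h1 : s ≤ 2 ^ k * s := le_mul_of_one_le_left hs0.le (one_le_pow₀ one_le_two)
      have h2 := hR (2 ^ k * s) ((le_max_left _ _).trans (hs.trans h1))
      rw [div_lt_iff₀ (hpos _ (by positivity))] at h2
      calc ν (2 ^ (k + 1) * s) = ν (2 * (2 ^ k * s)) := by ring_nf
        _ ≤ (2 : ℝ) ^ (-q) * ν (2 ^ k * s) := h2.le
        _ ≤ (2 : ℝ) ^ (-q) * (((2 : ℝ) ^ (-q)) ^ k * ν s) := by gcongr
        _ = _ := by ring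
  obtain ⟨k, hk1, hk2⟩ := exists_nat_pow_near ((one_le_div hs0).2 hsr) (one_lt_two (α := ℝ))
  have h3 : 2 ^ k * s ≤ r := (le_div_iff₀ hs0).1 hk1
  have h4 : ν r ≤ ν (2 ^ k * s) := hanti _ _ (by positivity) h3
  refine h4.trans ((hiter k).trans (mul_le_mul_of_nonneg_right ?_ (hpos s hs0).le))
  have h5 : ((2 : ℝ) ^ (-q)) ^ k = (2 : ℝ) ^ q * (((2 : ℝ) ^ (k + 1))⁻¹) ^ q := by
    rw [← Real.rpow_natCast, ← Real.rpow_mul two_pos.le, ← Real.rpow_natCast 2 (k + 1),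
      ← Real.rpow_neg two_pos.le, ← Real.rpow_mul two_pos.le, ← Real.rpow_add two_pos]
    congr 1
    push_cast
    ring
  rw [h5]
  have h6 : ((2 : ℝ) ^ (k + 1))⁻¹ ≤ s / r := by
    rw [← inv_div r s]
    exact inv_anti₀ (by positivity) hk2.le
  gcongr

namespace IsScalingLevyDensity

variable {d : ℕ} {ν : ℝ → ℝ} {β M γ r₀ C : ℝ}

lemma pow_mul_lower (h : IsScalingLevyDensity d ν β M γ r₀ C) {s r : ℝ} (hs : 0 < s)
    (hsr : s ≤ r) : s ^ d * ν s ≤ M * (r / s) ^ β * (r ^ d * ν r) := by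
  have hr : 0 < r := hs.trans_le hsr
  refine (mul_le_mul_of_nonneg_left (h.lower s r hs hsr) (by positivity)).trans (le_of_eq ?_)
  rw [Real.rpow_add (by positivity), Real.rpow_natCast, div_pow]
  field_simp

lemma pow_mul_upper (h : IsScalingLevyDensity d ν β M γ r₀ C) {s r : ℝ} (hs : r₀ ≤ s)
    (hsr : s ≤ r) : r ^ d * ν r ≤ C * (s / r) ^ γ * (s ^ d * ν s) := by
  have hs0 : 0 < s := by linarith [h.one_le_r₀]
  have hr : 0 < r := hs0.trans_le hsr
  refine (mul_le_mul_of_nonneg_left (h.upper s r hs hsr) (by positivity)).trans (le_of_eq ?_)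
  rw [Real.rpow_add (by positivity), Real.rpow_natCast, div_pow]
  field_simp

/-- The scale-invariant majorant of `z ↦ (|z|² ∧ 1) ν(|z|)`. -/
def majorant (d : ℕ) (β M γ C y : ℝ) : ℝ :=
  if y < 1 then M * (y ^ 2 * y ^ (-((d : ℝ) + β))) else C * y ^ (-((d : ℝ) + γ))

lemma integrable_majorant (h : IsScalingLevyDensity d ν β M γ r₀ C) :
    Integrable (fun w : EuclideanSpace ℝ (Fin d) => majorant d β M γ C ‖w‖) := by
  have := h.nontrivial
  have hfin : Module.finrank ℝ (EuclideanSpace ℝ (Fin d)) = d := by simp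
  rw [integrable_fun_norm_addHaar, hfin, ← Set.Ioo_union_Ici_eq_Ioi one_pos]
  have hd : ((d - 1 : ℕ) : ℝ) = (d : ℝ) - 1 := by
    rw [Nat.cast_sub h.dim_pos, Nat.cast_one]
  refine IntegrableOn.union ?_ ?_
  · have h1 : IntegrableOn (fun y : ℝ => M * y ^ (1 - β)) (Set.Ioo 0 1) := by
      have h2 : IntervalIntegrable (fun y : ℝ => y ^ (1 - β)) volume 0 1 :=
        intervalIntegral.intervalIntegrable_rpow' (by linarith [h.beta_lt])
      rw [intervalIntegrable_iff_integrableOn_Ioo_of_le zero_le_one] at h2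
      exact h2.const_mul M
    refine h1.congr_fun (fun y hy => ?_) measurableSet_Ioo
    have hy0 : 0 < y := hy.1
    simp only [majorant, if_pos hy.2, smul_eq_mul]
    rw [← Real.rpow_natCast y (d - 1), hd, ← Real.rpow_natCast y 2, mul_left_comm (y ^ _) M,
      ← Real.rpow_add hy0, ← Real.rpow_add hy0]
    congr 2
    push_cast
    ring
  · have h1 : IntegrableOn (fun y : ℝ => C * y ^ (-1 - γ)) (Set.Ici 1) := by
      rw [integrableOn_Ici_iff_integrableOn_Ioi]
      exact (integrableOn_Ioi_rpow_of_lt (by linarith [h.gamma_pos]) one_pos).const_mul C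
    refine h1.congr_fun (fun y hy => ?_) measurableSet_Ici
    have hy0 : 0 < y := one_pos.trans_le hy
    simp only [majorant, if_neg (not_lt.2 (Set.mem_Ici.1 hy)), smul_eq_mul]
    rw [← Real.rpow_natCast y (d - 1), hd, mul_left_comm (y ^ _) C, ← Real.rpow_add hy0]
    congr 2
    ring

lemma min_mul_le_majorant (h : IsScalingLevyDensity d ν β M γ r₀ C) {r y : ℝ} (hr : r₀ ≤ r)
    (hy : 0 < y) :
    min (y ^ 2 / r ^ 2) 1 * ν y ≤ ν r * majorant d β M γ C (r⁻¹ * y) := by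
  have hr0 : 0 < r := by linarith [h.one_le_r₀]
  have hyr : 0 < r⁻¹ * y := by positivity
  have hsq : y ^ 2 / r ^ 2 = (r⁻¹ * y) ^ 2 := by field_simp
  have hinv : ∀ p : ℝ, (r⁻¹ * y) ^ (-p) = (r / y) ^ p := by
    intro p
    rw [Real.rpow_neg hyr.le, ← Real.inv_rpow hyr.le]
    congr 1
    field_simp
  have hν := h.pos y hy
  unfold majorant
  split_ifs with h1
  · have hle : y ≤ r := by
      rw [inv_mul_lt_iff₀ hr0, mul_one] at h1
      exact h1.le
    rw [hsq, hinv]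
    calc min ((r⁻¹ * y) ^ 2) 1 * ν y ≤ (r⁻¹ * y) ^ 2 * ν y := by gcongr; exact min_le_left _ _
      _ ≤ (r⁻¹ * y) ^ 2 * (M * (r / y) ^ ((d : ℝ) + β) * ν r) := by
          gcongr
          exact h.lower y r hy hle
      _ = _ := by ring
  · have hle : r ≤ y := by
      rw [inv_mul_lt_iff₀ hr0, mul_one] at h1
      exact not_lt.1 h1
    rw [hinv]
    calc min (y ^ 2 / r ^ 2) 1 * ν y ≤ 1 * ν y := by gcongr; exact min_le_right _ _
      _ ≤ C * (r / y) ^ ((d : ℝ) + γ) * ν r := by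
          rw [one_mul]
          exact h.upper r y hr hle
      _ = _ := by ring

lemma exists_hfun_le (h : IsScalingLevyDensity d ν β M γ r₀ C) :
    ∃ A : ℝ, 0 < A ∧ ∀ r, r₀ ≤ r → hfun d ν r ≤ A * (r ^ d * ν r) := by
  set I := ∫ w : EuclideanSpace ℝ (Fin d), majorant d β M γ C ‖w‖ with hI
  refine ⟨|I| + 1, by positivity, fun r hr => ?_⟩
  have hr0 : 0 < r := by linarith [h.one_le_r₀]
  have hν := h.pos r hr0
  have h1 : hfun d ν r ≤ ∫ z : EuclideanSpace ℝ (Fin d),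
      ν r * majorant d β M γ C ‖r⁻¹ • z‖ := by
    refine integral_mono_ae (h.integrable_min_div hr0)
      ((h.integrable_majorant.comp_smul (inv_ne_zero hr0.ne')).const_mul _) ?_
    filter_upwards [h.ae_ne_zero] with z hz
    rw [norm_smul, Real.norm_of_nonneg (inv_nonneg.2 hr0.le)]
    exact h.min_mul_le_majorant hr (norm_pos_iff.2 hz)
  rw [integral_const_mul, Measure.integral_comp_inv_smul_of_nonneg volume
    (fun w : EuclideanSpace ℝ (Fin d) => majorant d β M γ C ‖w‖) hr0.le, ← hI] at h1
  simp only [finrank_euclideanSpace, Fintype.card_fin, smul_eq_mul] at h1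
  refine h1.trans ?_
  have h2 : I ≤ |I| + 1 := by linarith [le_abs_self I]
  have h3 : 0 ≤ r ^ d * ν r := by positivity
  nlinarith

lemma exists_psi_le (h : IsScalingLevyDensity d ν β M γ r₀ C) :
    ∃ A : ℝ, 0 < A ∧ ∀ r, r₀ ≤ r → ∀ ξ : EuclideanSpace ℝ (Fin d),
      ψ d ν ξ ≤ A * (1 + r ^ 2 * ‖ξ‖ ^ 2) * (r ^ d * ν r) := by
  obtain ⟨A, hA, hA'⟩ := h.exists_hfun_le
  refine ⟨2 * A, by positivity, fun r hr ξ => ?_⟩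
  have hr0 : 0 < r := by linarith [h.one_le_r₀]
  have h1 : ψ d ν ξ ≤ ∫ z : EuclideanSpace ℝ (Fin d),
      2 * (1 + r ^ 2 * ‖ξ‖ ^ 2) * (min (‖z‖ ^ 2 / r ^ 2) 1 * ν ‖z‖) := by
    refine integral_mono_ae (h.integrable_one_sub_cos ξ)
      ((h.integrable_min_div hr0).const_mul _) ?_
    filter_upwards [h.ae_ne_zero] with z hz
    rw [← mul_assoc]
    exact mul_le_mul_of_nonneg_right (one_sub_cos_inner_le hr0 ξ z) (h.pos _ (norm_pos_iff.2 hz)).le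
  rw [integral_const_mul] at h1
  refine h1.trans ?_
  have h2 := mul_le_mul_of_nonneg_left (hA' r hr)
    (by positivity : 0 ≤ 2 * (1 + r ^ 2 * ‖ξ‖ ^ 2))
  unfold hfun at h2
  linarith

end IsScalingLevyDensity

lemma volume_ball_le_integral_one_sub_cos {V : Type*} [NormedAddCommGroup V]
    [InnerProductSpace ℝ V] [FiniteDimensional ℝ V] [MeasurableSpace V] [BorelSpace V]
    {r : ℝ} {ξ : V} (hr : 0 < r) (hξ : 1 ≤ r * ‖ξ‖) :
    volume.real (Metric.ball (0 : V) r) ≤ ∫ z in Metric.ball (0 : V) (5 * r),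
      (1 - Real.cos ⟪ξ, z⟫) := by
  set g : V → ℝ := fun z => 1 - Real.cos ⟪ξ, z⟫ with hg
  have hgc : Continuous g := by fun_prop
  have hg0 : ∀ z, 0 ≤ g z := fun z => one_sub_cos_nonneg _
  have hξ0 : 0 < ‖ξ‖ := by
    by_contra! hc
    have := mul_nonpos_of_nonneg_of_nonpos hr.le hc
    linarith
  set u : V := (π / ‖ξ‖ ^ 2) • ξ with hu
  have hgu : ∀ z, g (z + u) = 1 + Real.cos ⟪ξ, z⟫ := by
    intro z
    have : ⟪ξ, u⟫ = π := by
      rw [hu, inner_smul_right, real_inner_self_eq_norm_sq]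
      field_simp
    simp only [hg, inner_add_right, this, Real.cos_add_pi]
    ring
  have hun : ‖u‖ ≤ 4 * r := by
    rw [hu, norm_smul, Real.norm_of_nonneg (by positivity)]
    have h1 : π / ‖ξ‖ ^ 2 * ‖ξ‖ = π / ‖ξ‖ := by field_simp
    rw [h1, div_le_iff₀ hξ0]
    nlinarith [Real.pi_le_four]
  have hint : ∀ ρ : ℝ, ∀ v : V, IntegrableOn (fun z => g (z + v)) (Metric.ball 0 ρ) := fun ρ v =>
    ((hgc.comp (by fun_prop : Continuous fun z : V => z + v)).continuousOn.integrableOn_compact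
      (isCompact_closedBall 0 ρ)).mono_set Metric.ball_subset_closedBall
  have hint0 : ∀ ρ : ℝ, IntegrableOn g (Metric.ball 0 ρ) := fun ρ => by simpa using hint ρ 0
  have h1 : ∫ z in Metric.ball (0 : V) r, g z ≤ ∫ z in Metric.ball (0 : V) (5 * r), g z :=
    setIntegral_mono_set (hint0 _) (ae_of_all _ hg0)
      (Metric.ball_subset_ball (by linarith)).eventuallyLE
  have h2 : ∫ z in Metric.ball (0 : V) r, g (z + u) ≤ ∫ z in Metric.ball (0 : V) (5 * r), g z := by
    rw [← integral_indicator measurableSet_ball, ← integral_indicator measurableSet_ball]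
    rw [← integral_add_right_eq_self ((Metric.ball (0 : V) (5 * r)).indicator g) u]
    refine integral_mono ((integrable_indicator_iff measurableSet_ball).2 (hint r u))
      (((integrable_indicator_iff measurableSet_ball).2 (hint0 (5 * r))).comp_add_right u)
      fun z => ?_
    by_cases hz : z ∈ Metric.ball (0 : V) r
    · have hz' : z + u ∈ Metric.ball (0 : V) (5 * r) := by
        rw [mem_ball_zero_iff] at hz ⊢
        linarith [norm_add_le z u]
      rw [Set.indicator_of_mem hz, Set.indicator_of_mem hz']
    · rw [Set.indicator_of_notMem hz]
      exact Set.indicator_nonneg (fun z _ => hg0 z) _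
  have h3 : (∫ z in Metric.ball (0 : V) r, g z) + ∫ z in Metric.ball (0 : V) r, g (z + u) =
      2 * volume.real (Metric.ball (0 : V) r) := by
    rw [← integral_add (hint0 r) (hint r u)]
    have : ∀ z, g z + g (z + u) = 2 := fun z => by rw [hgu]; simp only [hg]; ring
    simp_rw [this]
    rw [setIntegral_const, smul_eq_mul, mul_comm]
  linarith

lemma volume_real_ball_euclidean {d : ℕ} {r : ℝ} (hr : 0 < r) :
    volume.real (Metric.ball (0 : EuclideanSpace ℝ (Fin d)) r) =
      r ^ d * volume.real (Metric.ball (0 : EuclideanSpace ℝ (Fin d)) 1) := by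
  rw [measureReal_def, Measure.addHaar_ball_of_pos _ _ hr, ENNReal.toReal_mul,
    ENNReal.toReal_ofReal (by positivity), measureReal_def]
  simp

lemma volume_real_unitBall_pos (d : ℕ) :
    0 < volume.real (Metric.ball (0 : EuclideanSpace ℝ (Fin d)) 1) :=
  ENNReal.toReal_pos (Metric.measure_ball_pos _ _ one_pos).ne' measure_ball_lt_top.ne

namespace IsScalingLevyDensity

variable {d : ℕ} {ν : ℝ → ℝ} {β M γ r₀ C : ℝ}

lemma exists_le_psi (h : IsScalingLevyDensity d ν β M γ r₀ C) :
    ∃ c : ℝ, 0 < c ∧ ∀ r, 0 < r → ∀ ξ : EuclideanSpace ℝ (Fin d), 1 ≤ r * ‖ξ‖ →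
      c * (r ^ d * ν r) ≤ ψ d ν ξ := by
  have hM : 0 < M := by linarith [h.one_le_M]
  have hvol := volume_real_unitBall_pos d
  set ω := volume.real (Metric.ball (0 : EuclideanSpace ℝ (Fin d)) 1) with hω
  refine ⟨ω / (M * 5 ^ ((d : ℝ) + β)), by positivity, fun r hr ξ hξ => ?_⟩
  have h1 := volume_ball_le_integral_one_sub_cos hr hξ
  rw [volume_real_ball_euclidean hr, ← hω] at h1
  have h2 : ν (5 * r) * ∫ z in Metric.ball (0 : EuclideanSpace ℝ (Fin d)) (5 * r),
      (1 - Real.cos ⟪ξ, z⟫) ≤ ψ d ν ξ := by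
    rw [← integral_const_mul, ← integral_indicator measurableSet_ball]
    refine integral_mono_ae ?_ (h.integrable_one_sub_cos ξ) ?_
    · rw [integrable_indicator_iff measurableSet_ball]
      exact ((by fun_prop : Continuous fun z : EuclideanSpace ℝ (Fin d) =>
        ν (5 * r) * (1 - Real.cos ⟪ξ, z⟫)).continuousOn.integrableOn_compact
        (isCompact_closedBall 0 (5 * r))).mono_set Metric.ball_subset_closedBall
    · filter_upwards [h.ae_ne_zero] with z hz
      have hz0 := norm_pos_iff.2 hz
      by_cases hz1 : z ∈ Metric.ball (0 : EuclideanSpace ℝ (Fin d)) (5 * r)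
      · rw [Set.indicator_of_mem hz1, mul_comm]
        exact mul_le_mul_of_nonneg_left (h.anti _ _ hz0 (mem_ball_zero_iff.1 hz1).le)
          (one_sub_cos_nonneg _)
      · rw [Set.indicator_of_notMem hz1]
        exact mul_nonneg (one_sub_cos_nonneg _) (h.pos _ hz0).le
  have h3 := h.lower r (5 * r) hr (by linarith)
  rw [mul_div_cancel_right₀ _ hr.ne'] at h3
  have h4 : ν r / (M * 5 ^ ((d : ℝ) + β)) ≤ ν (5 * r) := by
    rw [div_le_iff₀ (by positivity)]
    linarith
  calc ω / (M * 5 ^ ((d : ℝ) + β)) * (r ^ d * ν r)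
      = ν r / (M * 5 ^ ((d : ℝ) + β)) * (r ^ d * ω) := by ring
    _ ≤ ν (5 * r) * (r ^ d * ω) := by gcongr
    _ ≤ _ := by
      refine (mul_le_mul_of_nonneg_left h1 ?_).trans h2
      exact (h.pos _ (by positivity)).le

end IsScalingLevyDensity

namespace IsUnimodalLevyDensity

variable {d : ℕ} {ν : ℝ → ℝ}

lemma psistar_eq (d : ℕ) (ν : ℝ → ℝ) (r : ℝ) :
    ψstar d ν r = sSup (ψ d ν '' Metric.closedBall 0 r) := by
  simp [ψstar, Set.image]

lemma psi_le_psistar (h : IsUnimodalLevyDensity d ν) {r : ℝ} {z : EuclideanSpace ℝ (Fin d)}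
    (hz : ‖z‖ ≤ r) : ψ d ν z ≤ ψstar d ν r := by
  rw [psistar_eq]
  exact le_csSup ((isCompact_closedBall 0 r).image h.continuous_psi).bddAbove
    (Set.mem_image_of_mem _ (by simpa using hz))

lemma psistar_le {r B : ℝ} (hr : 0 ≤ r)
    (hB : ∀ z : EuclideanSpace ℝ (Fin d), ‖z‖ ≤ r → ψ d ν z ≤ B) : ψstar d ν r ≤ B := by
  rw [psistar_eq]
  refine csSup_le ((Metric.nonempty_closedBall.2 hr).image _) ?_
  rintro _ ⟨z, hz, rfl⟩
  exact hB z (by simpa using hz)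

lemma psistar_mono (h : IsUnimodalLevyDensity d ν) {r s : ℝ} (hr : 0 ≤ r) (hrs : r ≤ s) :
    ψstar d ν r ≤ ψstar d ν s :=
  psistar_le hr fun _ hz => h.psi_le_psistar (hz.trans hrs)

lemma psistar_zero (h : IsUnimodalLevyDensity d ν) : ψstar d ν 0 = 0 := by
  have h0 : ψ d ν 0 = 0 := by simp [ψ]
  refine le_antisymm (psistar_le le_rfl fun z hz => ?_) ?_
  · rw [norm_le_zero_iff.1 hz, h0]
  · exact h0.symm.le.trans (h.psi_le_psistar (by rw [norm_zero]))

lemma continuousOn_psistar (h : IsUnimodalLevyDensity d ν) :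
    ContinuousOn (ψstar d ν) (Set.Ici 0) := by
  have hc : Continuous fun r : ℝ => sSup ((fun w : EuclideanSpace ℝ (Fin d) => ψ d ν (r • w)) ''
      Metric.closedBall 0 1) := by
    refine IsCompact.continuous_sSup (isCompact_closedBall 0 1) ?_
    exact h.continuous_psi.comp (by fun_prop : Continuous fun p : ℝ × EuclideanSpace ℝ (Fin d) =>
      p.1 • p.2)
  refine hc.continuousOn.congr fun r hr => ?_
  have hr' : 0 ≤ r := hr
  have himg : (fun w : EuclideanSpace ℝ (Fin d) => r • w) '' Metric.closedBall 0 1 =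
      Metric.closedBall 0 r := by
    have := smul_unitClosedBall_of_nonneg (E := EuclideanSpace ℝ (Fin d)) hr'
    rwa [← Set.image_smul] at this
  rw [psistar_eq, ← himg, Set.image_image]

lemma psistar_psiinv (h : IsUnimodalLevyDensity d ν) {u s : ℝ} (hu : 0 < u) (hs : 0 ≤ s)
    (hus : u < ψstar d ν s) :
    0 < ψinv d ν u ∧ ψinv d ν u ≤ s ∧ ψstar d ν (ψinv d ν u) = u := by
  set S := {r : ℝ | 0 ≤ r ∧ ψstar d ν r = u} with hS
  have hbdd : ∀ r ∈ S, r ≤ s := by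
    rintro r ⟨h0, h1⟩
    by_contra! hc
    have := h.psistar_mono hs hc.le
    linarith
  have hne : S.Nonempty := by
    obtain ⟨r, hr, hr'⟩ := intermediate_value_Icc hs
      (h.continuousOn_psistar.mono Set.Icc_subset_Ici_self)
      (show u ∈ Set.Icc (ψstar d ν 0) (ψstar d ν s) from ⟨by rw [h.psistar_zero]; exact hu.le,
        hus.le⟩)
    exact ⟨r, hr.1, hr'⟩
  have hcl : IsClosed S := by
    have : S = Set.Ici 0 ∩ ψstar d ν ⁻¹' {u} := by
      ext r
      simp [hS]
    rw [this]
    exact h.continuousOn_psistar.preimage_isClosed_of_isClosed isClosed_Ici isClosed_singleton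
  have hmem : ψinv d ν u ∈ S := hcl.csSup_mem hne ⟨s, hbdd⟩
  refine ⟨lt_of_le_of_ne hmem.1 fun h0 => ?_, hbdd _ hmem, hmem.2⟩
  have := hmem.2
  rw [← h0, h.psistar_zero] at this
  exact hu.ne this

end IsUnimodalLevyDensity

namespace IsScalingLevyDensity

variable {d : ℕ} {ν : ℝ → ℝ} {β M γ r₀ C : ℝ}

lemma exists_norm_eq (h : IsScalingLevyDensity d ν β M γ r₀ C) {r : ℝ} (hr : 0 ≤ r) :
    ∃ x : EuclideanSpace ℝ (Fin d), ‖x‖ = r := by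
  have := h.nontrivial
  exact _root_.exists_norm_eq _ hr

/-- The spatial scale `R = 1/ψ⁻¹(1/t)` at time `t` is large and satisfies `t R^d ν(R) ≍ 1`. -/
lemma exists_scale (h : IsScalingLevyDensity d ν β M γ r₀ C) :
    ∃ a b : ℝ, 0 < a ∧ 0 < b ∧ ∀ R₁, r₀ ≤ R₁ → ∃ T, 0 < T ∧ ∀ t, T ≤ t → ∃ R, R₁ ≤ R ∧
      ψinv d ν (1 / t) = R⁻¹ ∧ a ≤ t * (R ^ d * ν R) ∧ t * (R ^ d * ν R) ≤ b := by
  obtain ⟨A, hA, hup⟩ := h.exists_psi_le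
  obtain ⟨c, hc, hlow⟩ := h.exists_le_psi
  refine ⟨1 / (2 * A), 1 / c, by positivity, by positivity, fun R₁ hR₁ => ?_⟩
  have hlow' : ∀ R : ℝ, 0 < R → c * (R ^ d * ν R) ≤ ψstar d ν R⁻¹ := by
    intro R hR
    obtain ⟨x, hx⟩ := h.exists_norm_eq (inv_nonneg.2 hR.le)
    exact (hlow R hR x (by rw [hx, mul_inv_cancel₀ hR.ne'])).trans (h.psi_le_psistar hx.le)
  have hR₁0 : 0 < R₁ := by linarith [h.one_le_r₀]
  have hu0 : 0 < ψstar d ν R₁⁻¹ := by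
    have := h.pos R₁ hR₁0
    exact lt_of_lt_of_le (by positivity) (hlow' R₁ hR₁0)
  refine ⟨2 / ψstar d ν R₁⁻¹, by positivity, fun t ht => ?_⟩
  have ht0 : 0 < t := lt_of_lt_of_le (by positivity) ht
  have hut : 1 / t < ψstar d ν R₁⁻¹ := by
    rw [div_le_iff₀ hu0] at ht
    rw [div_lt_iff₀ ht0]
    linarith
  obtain ⟨h1, h2, h3⟩ := h.psistar_psiinv (by positivity : 0 < 1 / t) (by positivity) hut
  set ρ := ψinv d ν (1 / t) with hρ
  have hR : R₁ ≤ ρ⁻¹ := by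
    rw [le_inv_comm₀ hR₁0 h1]
    exact h2
  refine ⟨ρ⁻¹, hR, (inv_inv _).symm, ?_, ?_⟩
  · have h4 : ψstar d ν ρ ≤ 2 * A * (ρ⁻¹ ^ d * ν ρ⁻¹) := by
      refine IsUnimodalLevyDensity.psistar_le h1.le fun z hz => ?_
      refine (hup ρ⁻¹ (hR₁.trans hR) z).trans ?_
      have h5 : ρ⁻¹ ^ 2 * ‖z‖ ^ 2 ≤ 1 := by
        rw [← mul_pow]
        refine pow_le_one₀ (by positivity) ?_
        rw [inv_mul_le_iff₀ h1, mul_one]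
        exact hz
      have h6 := h.pos ρ⁻¹ (by positivity)
      have h7 : A * (1 + ρ⁻¹ ^ 2 * ‖z‖ ^ 2) ≤ 2 * A := by nlinarith
      exact mul_le_mul_of_nonneg_right h7 (by positivity)
    rw [h3, div_le_iff₀ ht0] at h4
    rw [div_le_iff₀ (by positivity)]
    linarith
  · have h4 := hlow' ρ⁻¹ (by positivity)
    rw [inv_inv, h3, le_div_iff₀ ht0] at h4
    rw [le_div_iff₀ hc]
    linarith

end IsScalingLevyDensity

/-- The density of the centred Gaussian law on `ℝ^d` with covariance matrix `2 I`. -/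
def gaussianWeight (d : ℕ) (η : EuclideanSpace ℝ (Fin d)) : ℝ :=
  (4 * Real.pi) ^ (-((d : ℝ) / 2)) * Real.exp (-(1 / 4) * ‖η‖ ^ 2)

lemma gaussianWeight_pos (d : ℕ) (η : EuclideanSpace ℝ (Fin d)) : 0 < gaussianWeight d η := by
  unfold gaussianWeight; positivity

lemma integrable_gaussianWeight (d : ℕ) : Integrable (gaussianWeight d) :=
  (integrable_exp_neg_mul_norm_sq (by norm_num)).const_mul _

lemma integral_gaussianWeight (d : ℕ) : ∫ η, gaussianWeight d η = 1 := by
  unfold gaussianWeight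
  rw [integral_const_mul, GaussianFourier.integral_rexp_neg_mul_sq_norm (by norm_num),
    Real.rpow_neg (by positivity), finrank_euclideanSpace_fin, div_div_eq_mul_div, div_one,
    mul_comm Real.pi 4]
  exact inv_mul_cancel₀ (by positivity)

lemma integrable_norm_sq_mul_gaussianWeight (d : ℕ) :
    Integrable (fun η => ‖η‖ ^ 2 * gaussianWeight d η) := by
  have h1 : Integrable (fun η : EuclideanSpace ℝ (Fin d) =>
      8 * (4 * Real.pi) ^ (-((d : ℝ) / 2)) * Real.exp (-(1 / 8) * ‖η‖ ^ 2)) :=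
    (integrable_exp_neg_mul_norm_sq (by norm_num)).const_mul _
  refine h1.mono' (by unfold gaussianWeight; fun_prop) (ae_of_all _ fun η => ?_)
  rw [Real.norm_of_nonneg (mul_nonneg (by positivity) (gaussianWeight_pos d η).le)]
  unfold gaussianWeight
  have h2 := Real.add_one_le_exp (1 / 8 * ‖η‖ ^ 2)
  have h3 : Real.exp (-(1 / 8) * ‖η‖ ^ 2) =
      Real.exp (1 / 8 * ‖η‖ ^ 2) * Real.exp (-(1 / 4) * ‖η‖ ^ 2) := by
    rw [← Real.exp_add]; ring_nf
  rw [h3]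
  have h4 : ‖η‖ ^ 2 ≤ 8 * Real.exp (1 / 8 * ‖η‖ ^ 2) := by linarith
  calc ‖η‖ ^ 2 * ((4 * Real.pi) ^ (-((d : ℝ) / 2)) * Real.exp (-(1 / 4) * ‖η‖ ^ 2))
      ≤ 8 * Real.exp (1 / 8 * ‖η‖ ^ 2) *
        ((4 * Real.pi) ^ (-((d : ℝ) / 2)) * Real.exp (-(1 / 4) * ‖η‖ ^ 2)) := by gcongr
    _ = _ := by ring

/-- The integral of the heat kernel against the Gaussian test function of width `r`. -/
def gaussianMass (d : ℕ) (ν : ℝ → ℝ) (t r : ℝ) : ℝ :=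
  ∫ x, pt d ν t x * Real.exp (-r⁻¹ ^ 2 * ‖x‖ ^ 2)

namespace IsUnimodalLevyDensity

variable {d : ℕ} {ν : ℝ → ℝ} {t : ℝ}

lemma radDec_pt (h : IsUnimodalLevyDensity d ν) (ht : 0 ≤ t)
    (hi : Integrable (fun ξ : EuclideanSpace ℝ (Fin d) => Real.exp (-(t * ψ d ν ξ)))) :
    RadiallyDecreasing (pt d ν t) := by
  have hu := (h.unimodalTransform_exp_neg ht hi).radDec
  exact ⟨fun x => mul_nonneg (by positivity) (hu.nonneg x),
    fun x y hxy => mul_le_mul_of_nonneg_left (hu.anti x y hxy) (by positivity)⟩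

lemma continuous_pt
    (hi : Integrable (fun ξ : EuclideanSpace ℝ (Fin d) => Real.exp (-(t * ψ d ν ξ)))) :
    Continuous (pt d ν t) :=
  continuous_const.mul (continuous_cosTransform hi)

lemma integrable_pt_mul (h : IsUnimodalLevyDensity d ν) (ht : 0 ≤ t)
    (hi : Integrable (fun ξ : EuclideanSpace ℝ (Fin d) => Real.exp (-(t * ψ d ν ξ))))
    {f : EuclideanSpace ℝ (Fin d) → ℝ} (hf : Integrable f) :
    Integrable (fun x => pt d ν t x * f x) := by
  have hrd := h.radDec_pt ht hi
  refine hf.bdd_mul (c := pt d ν t 0) (continuous_pt hi).aestronglyMeasurable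
    (ae_of_all _ fun x => ?_)
  rw [Real.norm_of_nonneg (hrd.nonneg x)]
  exact hrd.anti 0 x (by simp)

lemma gaussianMass_eq (h : IsUnimodalLevyDensity d ν) (ht : 0 ≤ t)
    (hi : Integrable (fun ξ : EuclideanSpace ℝ (Fin d) => Real.exp (-(t * ψ d ν ξ))))
    {r : ℝ} (hr : 0 < r) :
    gaussianMass d ν t r = ∫ η, Real.exp (-(t * ψ d ν (r⁻¹ • η))) * gaussianWeight d η := by
  set φ : EuclideanSpace ℝ (Fin d) → ℝ := fun ξ => Real.exp (-(t * ψ d ν ξ)) with hφ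
  have hε : 0 < r⁻¹ ^ 2 := by positivity
  have hu := (h.unimodalTransform_exp_neg ht hi).radDec
  have h1 := cosTransform_mul_cosTransform hi
    (integrable_exp_neg_mul_norm_sq (V := EuclideanSpace ℝ (Fin d)) hε) (by simp) 0
  have h2 : gaussianMass d ν t r = ((2 * Real.pi) ^ d)⁻¹ *
      ∫ z, Real.exp (-r⁻¹ ^ 2 * ‖z‖ ^ 2) * cosTransform φ (0 - z) := by
    rw [gaussianMass, ← integral_const_mul]
    congr 1
    ext z
    have : cosTransform φ (0 - z) = cosTransform φ z := hu.congr_norm (by simp)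
    rw [this]
    show ((2 * Real.pi) ^ d)⁻¹ * cosTransform φ z * _ = _
    ring
  rw [h2, ← h1, cosTransform]
  simp only [inner_zero_right, Real.cos_zero, one_mul, cosTransform_gaussian hε,
    finrank_euclideanSpace_fin]
  have h3 := Measure.integral_comp_smul_of_nonneg (volume : Measure (EuclideanSpace ℝ (Fin d)))
    (fun η => φ (r⁻¹ • η) * Real.exp (-(1 / 4) * ‖η‖ ^ 2)) r (hR := hr.le)
  simp only [smul_smul, inv_mul_cancel₀ hr.ne', one_smul, finrank_euclideanSpace_fin,
    smul_eq_mul] at h3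
  have h4 : ∀ ξ : EuclideanSpace ℝ (Fin d),
      (Real.pi / r⁻¹ ^ 2) ^ ((d : ℝ) / 2) * Real.exp (-(‖ξ‖ ^ 2 / (4 * r⁻¹ ^ 2))) * φ ξ =
      (Real.pi / r⁻¹ ^ 2) ^ ((d : ℝ) / 2) *
        (φ ξ * Real.exp (-(1 / 4) * ‖r • ξ‖ ^ 2)) := by
    intro ξ
    have : -(‖ξ‖ ^ 2 / (4 * r⁻¹ ^ 2)) = -(1 / 4) * ‖r • ξ‖ ^ 2 := by
      rw [norm_smul, Real.norm_of_nonneg hr.le]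
      field_simp
    rw [this]
    ring
  simp_rw [h4]
  rw [integral_const_mul, h3]
  have h5 : ∀ η, φ (r⁻¹ • η) * gaussianWeight d η = (4 * Real.pi) ^ (-((d : ℝ) / 2)) *
      (φ (r⁻¹ • η) * Real.exp (-(1 / 4) * ‖η‖ ^ 2)) := by
    intro η
    unfold gaussianWeight
    ring
  have h6 : ∫ η, Real.exp (-(t * ψ d ν (r⁻¹ • η))) * gaussianWeight d η =
      (4 * Real.pi) ^ (-((d : ℝ) / 2)) *
        ∫ η, φ (r⁻¹ • η) * Real.exp (-(1 / 4) * ‖η‖ ^ 2) := by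
    rw [← integral_const_mul]
    exact integral_congr_ae (ae_of_all _ h5)
  rw [h6, ← mul_assoc, ← mul_assoc]
  congr 1
  have h7 : (Real.pi / r⁻¹ ^ 2) ^ ((d : ℝ) / 2) = Real.pi ^ ((d : ℝ) / 2) * r ^ d := by
    rw [inv_pow, div_inv_eq_mul, Real.mul_rpow (by positivity) (by positivity),
      ← Real.rpow_natCast r 2, ← Real.rpow_mul hr.le, ← Real.rpow_natCast r d]
    congr 2
    push_cast
    ring
  have h8 : (4 * Real.pi) ^ (-((d : ℝ) / 2)) * Real.pi ^ (-((d : ℝ) / 2)) =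
      ((2 * Real.pi) ^ d)⁻¹ := by
    rw [← Real.mul_rpow (by positivity) (by positivity), Real.rpow_neg (by positivity),
      show 4 * Real.pi * Real.pi = (2 * Real.pi) ^ (2 : ℝ) by rw [Real.rpow_two]; ring,
      ← Real.rpow_mul (by positivity), ← Real.rpow_natCast]
    congr 2
    ring
  rw [h7, ← h8, Real.rpow_neg (x := Real.pi) (by positivity)]
  field_simp

lemma integrable_exp_mul_gaussianWeight (h : IsUnimodalLevyDensity d ν) (ht : 0 ≤ t) (r : ℝ) :
    Integrable (fun η => Real.exp (-(t * ψ d ν (r⁻¹ • η))) * gaussianWeight d η) := by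
  refine (integrable_gaussianWeight d).bdd_mul (c := 1) ?_ (ae_of_all _ fun η => ?_)
  · have := h.continuous_psi
    exact (by fun_prop : Continuous fun η : EuclideanSpace ℝ (Fin d) =>
      Real.exp (-(t * ψ d ν (r⁻¹ • η)))).aestronglyMeasurable
  · rw [Real.norm_of_nonneg (Real.exp_nonneg _), Real.exp_le_one_iff, neg_nonpos]
    exact mul_nonneg ht (h.psi_nonneg _)

lemma one_sub_gaussianMass_eq (h : IsUnimodalLevyDensity d ν) (ht : 0 ≤ t)
    (hi : Integrable (fun ξ : EuclideanSpace ℝ (Fin d) => Real.exp (-(t * ψ d ν ξ))))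
    {r : ℝ} (hr : 0 < r) :
    1 - gaussianMass d ν t r =
      ∫ η, (1 - Real.exp (-(t * ψ d ν (r⁻¹ • η)))) * gaussianWeight d η := by
  rw [h.gaussianMass_eq ht hi hr]
  nth_rw 1 [← integral_gaussianWeight d]
  rw [← integral_sub (integrable_gaussianWeight d) (h.integrable_exp_mul_gaussianWeight ht r)]
  congr 1
  ext η
  ring

lemma integrable_one_sub_exp_mul_gaussianWeight (h : IsUnimodalLevyDensity d ν) (ht : 0 ≤ t)
    (r : ℝ) :
    Integrable (fun η => (1 - Real.exp (-(t * ψ d ν (r⁻¹ • η)))) * gaussianWeight d η) := by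
  refine ((integrable_gaussianWeight d).sub
    (h.integrable_exp_mul_gaussianWeight ht r)).congr (ae_of_all _ fun η => ?_)
  simp only [Pi.sub_apply]
  ring

lemma one_sub_exp_mul_gaussianWeight_nonneg (h : IsUnimodalLevyDensity d ν) (ht : 0 ≤ t)
    (r : ℝ) (η : EuclideanSpace ℝ (Fin d)) :
    0 ≤ (1 - Real.exp (-(t * ψ d ν (r⁻¹ • η)))) * gaussianWeight d η := by
  refine mul_nonneg (sub_nonneg.2 (Real.exp_le_one_iff.2 (neg_nonpos.2 ?_)))
    (gaussianWeight_pos d η).le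
  exact mul_nonneg ht (h.psi_nonneg _)

lemma gaussianMass_le_one (h : IsUnimodalLevyDensity d ν) (ht : 0 ≤ t)
    (hi : Integrable (fun ξ : EuclideanSpace ℝ (Fin d) => Real.exp (-(t * ψ d ν ξ))))
    {r : ℝ} (hr : 0 < r) : gaussianMass d ν t r ≤ 1 := by
  have h1 : 0 ≤ 1 - gaussianMass d ν t r := by
    rw [h.one_sub_gaussianMass_eq ht hi hr]
    exact integral_nonneg (h.one_sub_exp_mul_gaussianWeight_nonneg ht r)
  linarith

end IsUnimodalLevyDensity

namespace IsScalingLevyDensity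

variable {d : ℕ} {ν : ℝ → ℝ} {β M γ r₀ C : ℝ}

lemma exists_one_sub_gaussianMass_le (h : IsScalingLevyDensity d ν β M γ r₀ C) :
    ∃ A : ℝ, 0 < A ∧ ∀ t r, 0 ≤ t →
      Integrable (fun ξ : EuclideanSpace ℝ (Fin d) => Real.exp (-(t * ψ d ν ξ))) → r₀ ≤ r →
      1 - gaussianMass d ν t r ≤ A * (t * (r ^ d * ν r)) := by
  obtain ⟨A, hA, hA'⟩ := h.exists_psi_le
  set I := ∫ η : EuclideanSpace ℝ (Fin d), ‖η‖ ^ 2 * gaussianWeight d η with hI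
  have hI0 : 0 ≤ I := integral_nonneg fun η => mul_nonneg (by positivity)
    (gaussianWeight_pos d η).le
  refine ⟨A * (1 + I), by positivity, fun t r ht hi hr => ?_⟩
  have hr0 : 0 < r := by linarith [h.one_le_r₀]
  rw [h.one_sub_gaussianMass_eq ht hi hr0]
  have hint : Integrable (fun η : EuclideanSpace ℝ (Fin d) =>
      A * (t * (r ^ d * ν r)) * (gaussianWeight d η + ‖η‖ ^ 2 * gaussianWeight d η)) :=
    ((integrable_gaussianWeight d).add (integrable_norm_sq_mul_gaussianWeight d)).const_mul _
  refine (integral_mono (h.integrable_one_sub_exp_mul_gaussianWeight ht r) hint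
    fun η => ?_).trans (le_of_eq ?_)
  · have h1 := Real.add_one_le_exp (-(t * ψ d ν (r⁻¹ • η)))
    have h2 := hA' r hr (r⁻¹ • η)
    have h3 : r ^ 2 * ‖r⁻¹ • η‖ ^ 2 = ‖η‖ ^ 2 := by
      rw [norm_smul, Real.norm_of_nonneg (by positivity)]
      field_simp
    rw [h3] at h2
    have h4 := mul_le_mul_of_nonneg_left h2 ht
    have h5 : 1 - Real.exp (-(t * ψ d ν (r⁻¹ • η))) ≤
        t * (A * (1 + ‖η‖ ^ 2) * (r ^ d * ν r)) := by linarith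
    refine (mul_le_mul_of_nonneg_right h5 (gaussianWeight_pos d η).le).trans (le_of_eq ?_)
    ring
  · rw [integral_const_mul, integral_add (integrable_gaussianWeight d)
      (integrable_norm_sq_mul_gaussianWeight d), integral_gaussianWeight]
    ring

end IsScalingLevyDensity

lemma le_volume_real_annulus {d : ℕ} (hd : 1 ≤ d) {r : ℝ} (hr : 0 < r) :
    volume.real (Metric.ball (0 : EuclideanSpace ℝ (Fin d)) 1) / 2 * r ^ d ≤
      volume.real (Metric.ball (0 : EuclideanSpace ℝ (Fin d)) r \ Metric.ball 0 (r / 2)) := by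
  rw [measureReal_sdiff (Metric.ball_subset_ball (by linarith)) measurableSet_ball,
    volume_real_ball_euclidean hr, volume_real_ball_euclidean (by positivity : 0 < r / 2), div_pow]
  have hω := volume_real_unitBall_pos d
  have h2 : (2 : ℝ) ≤ 2 ^ d := by
    calc (2 : ℝ) = 2 ^ 1 := by norm_num
      _ ≤ 2 ^ d := pow_le_pow_right₀ one_le_two hd
  have h3 : r ^ d / 2 ^ d ≤ r ^ d / 2 := by gcongr
  nlinarith

lemma exp_gaussian_sub_nonneg {r s y : ℝ} (hr : 0 < r) (hrs : r ≤ s) :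
    0 ≤ Real.exp (-s⁻¹ ^ 2 * y ^ 2) - Real.exp (-r⁻¹ ^ 2 * y ^ 2) := by
  have h1 : s⁻¹ ≤ r⁻¹ := inv_anti₀ hr hrs
  have h2 : 0 < s⁻¹ := inv_pos.2 (hr.trans_le hrs)
  rw [sub_nonneg, Real.exp_le_exp]
  have : s⁻¹ ^ 2 * y ^ 2 ≤ r⁻¹ ^ 2 * y ^ 2 := by gcongr
  linarith

lemma le_exp_gaussian_sub {r y : ℝ} (hr : 0 < r) (hy : r / 2 ≤ y) (hyr : y ≤ r) :
    Real.exp (-1) * (3 / 16) ≤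
      Real.exp (-(2 * r)⁻¹ ^ 2 * y ^ 2) - Real.exp (-r⁻¹ ^ 2 * y ^ 2) := by
  set u := r⁻¹ * y with hu
  have hu1 : 1 / 2 ≤ u := by
    rw [hu, inv_mul_eq_div, le_div_iff₀ hr]; linarith
  have hu2 : u ≤ 1 := by
    rw [hu, inv_mul_eq_div, div_le_iff₀ hr]; linarith
  have e1 : -r⁻¹ ^ 2 * y ^ 2 = -u ^ 2 := by rw [hu]; ring
  have e2 : -(2 * r)⁻¹ ^ 2 * y ^ 2 = -u ^ 2 + 3 / 4 * u ^ 2 := by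
    rw [hu, mul_inv]; ring
  rw [e1, e2, Real.exp_add]
  have h1 := Real.add_one_le_exp (3 / 4 * u ^ 2)
  have h2 : Real.exp (-1) ≤ Real.exp (-u ^ 2) := Real.exp_le_exp.2 (by nlinarith)
  have h3 : 3 / 16 ≤ Real.exp (3 / 4 * u ^ 2) - 1 := by nlinarith
  calc Real.exp (-1) * (3 / 16) ≤ Real.exp (-u ^ 2) * (Real.exp (3 / 4 * u ^ 2) - 1) := by gcongr
    _ = _ := by ring

lemma IsUnimodalLevyDensity.gaussianMass_sub_eq {d : ℕ} {ν : ℝ → ℝ} {t : ℝ}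
    (h : IsUnimodalLevyDensity d ν) (ht : 0 ≤ t)
    (hi : Integrable (fun ξ : EuclideanSpace ℝ (Fin d) => Real.exp (-(t * ψ d ν ξ))))
    {r s : ℝ} (hr : 0 < r) (hs : 0 < s) :
    gaussianMass d ν t s - gaussianMass d ν t r = ∫ x, pt d ν t x *
      (Real.exp (-s⁻¹ ^ 2 * ‖x‖ ^ 2) - Real.exp (-r⁻¹ ^ 2 * ‖x‖ ^ 2)) := by
  have hg : ∀ {r : ℝ}, 0 < r → Integrable (fun x : EuclideanSpace ℝ (Fin d) =>
      Real.exp (-r⁻¹ ^ 2 * ‖x‖ ^ 2)) := fun hr => integrable_exp_neg_mul_norm_sq (by positivity)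
  rw [gaussianMass, gaussianMass, ← integral_sub (h.integrable_pt_mul ht hi (hg hs))
    (h.integrable_pt_mul ht hi (hg hr))]
  congr 1
  ext x
  ring

namespace IsScalingLevyDensity

variable {d : ℕ} {ν : ℝ → ℝ} {β M γ r₀ C : ℝ}

lemma exists_pt_le_of_le_norm (h : IsScalingLevyDensity d ν β M γ r₀ C) :
    ∃ A : ℝ, 0 < A ∧ ∀ t, 0 ≤ t →
      Integrable (fun ξ : EuclideanSpace ℝ (Fin d) => Real.exp (-(t * ψ d ν ξ))) →
      ∀ x : EuclideanSpace ℝ (Fin d), r₀ ≤ ‖x‖ → pt d ν t x ≤ A * (t * ν ‖x‖) := by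
  obtain ⟨A, hA, hA'⟩ := h.exists_one_sub_gaussianMass_le
  have hω := volume_real_unitBall_pos d
  set ω := volume.real (Metric.ball (0 : EuclideanSpace ℝ (Fin d)) 1) with hωdef
  set δ := Real.exp (-1) * (3 / 16) with hδ
  have hδ0 : 0 < δ := by positivity
  refine ⟨A / (δ * (ω / 2)), by positivity, fun t ht hi x hx => ?_⟩
  set r := ‖x‖ with hr
  have hr0 : 0 < r := by linarith [h.one_le_r₀]
  have hrd := h.radDec_pt ht hi
  have h1 : gaussianMass d ν t (2 * r) - gaussianMass d ν t r ≤ A * (t * (r ^ d * ν r)) :=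
    (sub_le_sub_right (h.gaussianMass_le_one ht hi (by positivity)) _).trans (hA' t r ht hi hx)
  set S := Metric.ball (0 : EuclideanSpace ℝ (Fin d)) r \ Metric.ball 0 (r / 2) with hS
  have hSm : MeasurableSet S := measurableSet_ball.diff measurableSet_ball
  have hSf : volume S ≠ ⊤ := ((measure_mono Set.sdiff_subset).trans_lt measure_ball_lt_top).ne
  have h2 : pt d ν t x * δ * volume.real S ≤
      gaussianMass d ν t (2 * r) - gaussianMass d ν t r := by
    rw [h.gaussianMass_sub_eq ht hi hr0 (by positivity)]
    have hind : ∫ y, S.indicator (fun _ => pt d ν t x * δ) y = pt d ν t x * δ * volume.real S := by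
      rw [integral_indicator hSm, setIntegral_const, smul_eq_mul, mul_comm]
    rw [← hind]
    refine integral_mono ((integrable_indicator_iff hSm).2 (integrableOn_const hSf))
      (h.integrable_pt_mul ht hi ((integrable_exp_neg_mul_norm_sq (by positivity)).sub
        (integrable_exp_neg_mul_norm_sq (by positivity)))) fun y => ?_
    by_cases hy : y ∈ S
    · rw [Set.indicator_of_mem hy]
      have hy1 : ‖y‖ < r := by simpa using hy.1
      have hy2 : r / 2 ≤ ‖y‖ := by simpa using hy.2
      exact mul_le_mul (hrd.anti y x hy1.le) (le_exp_gaussian_sub hr0 hy2 hy1.le) hδ0.le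
        (hrd.nonneg y)
    · rw [Set.indicator_of_notMem hy]
      exact mul_nonneg (hrd.nonneg y) (exp_gaussian_sub_nonneg hr0 (by linarith))
  have h3 := mul_le_mul_of_nonneg_left (le_volume_real_annulus h.dim_pos hr0)
    (mul_nonneg (hrd.nonneg x) hδ0.le)
  have h4 : pt d ν t x * (δ * (ω / 2)) * r ^ d ≤ A * (t * ν r) * r ^ d := by
    calc _ = pt d ν t x * δ * (ω / 2 * r ^ d) := by ring
      _ ≤ A * (t * (r ^ d * ν r)) := (h3.trans h2).trans h1
      _ = _ := by ring
  have h5 := le_of_mul_le_mul_right h4 (by positivity)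
  rw [div_mul_eq_mul_div, le_div_iff₀ (by positivity)]
  exact h5

end IsScalingLevyDensity

lemma integrable_exp_neg_mul_norm_rpow {d : ℕ} (hd : 1 ≤ d) {c p : ℝ} (hc : 0 < c) (hp : 0 < p) :
    Integrable (fun η : EuclideanSpace ℝ (Fin d) => Real.exp (-c * ‖η‖ ^ p)) := by
  have : Nonempty (Fin d) := ⟨⟨0, hd⟩⟩
  rw [integrable_fun_norm_addHaar volume (f := fun y : ℝ => Real.exp (-c * y ^ p)),
    finrank_euclideanSpace_fin]
  have h1 : (-1 : ℝ) < ((d - 1 : ℕ) : ℝ) := by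
    have : (0 : ℝ) ≤ ((d - 1 : ℕ) : ℝ) := Nat.cast_nonneg _
    linarith
  refine (integrableOn_rpow_mul_exp_neg_mul_rpow h1 hp hc).congr_fun (fun y _ => ?_)
    measurableSet_Ioi
  simp only [Real.rpow_natCast, smul_eq_mul]

namespace IsScalingLevyDensity

variable {d : ℕ} {ν : ℝ → ℝ} {β M γ r₀ C : ℝ}

/-- Exponentially small quantities in `t` are bounded by `R^{-d}` if `t R^d ν(R)` is bounded
below. -/
lemma exists_exp_neg_mul_pow_le (h : IsScalingLevyDensity d ν β M γ r₀ C) {a δ : ℝ} (ha : 0 < a)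
    (hδ : 0 < δ) :
    ∃ B : ℝ, 0 < B ∧ ∀ t R, 0 < t → r₀ ≤ R → a ≤ t * (R ^ d * ν R) →
      Real.exp (-(t * δ)) * R ^ d ≤ B := by
  have hr₀ : 0 < r₀ := by linarith [h.one_le_r₀]
  have hC : 0 < C := by linarith [h.one_le_C]
  have hν := h.pos r₀ hr₀
  have hγ := h.gamma_pos
  set K := C * r₀ ^ γ * (r₀ ^ d * ν r₀) / a with hK
  have hK0 : 0 < K := by positivity
  obtain ⟨n, hn⟩ := exists_nat_ge ((d : ℝ) / γ)
  refine ⟨K ^ n * n.factorial / δ ^ n, by positivity, fun t R ht hR hat => ?_⟩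
  have hR0 : 0 < R := hr₀.trans_le hR
  have h1 : R ^ γ ≤ K * t := by
    have h2 := h.pow_mul_upper le_rfl hR
    have h3 := hat.trans (mul_le_mul_of_nonneg_left h2 ht.le)
    rw [Real.div_rpow hr₀.le hR0.le] at h3
    have hRγ : 0 < R ^ γ := by positivity
    have h4 : t * (C * (r₀ ^ γ / R ^ γ) * (r₀ ^ d * ν r₀)) =
        t * (C * r₀ ^ γ * (r₀ ^ d * ν r₀)) / R ^ γ := by field_simp
    rw [h4, le_div_iff₀ hRγ] at h3
    rw [hK, div_mul_eq_mul_div, le_div_iff₀ ha]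
    linarith
  have h5 : R ^ d ≤ (K * t) ^ n := by
    calc R ^ d = R ^ (d : ℝ) := (Real.rpow_natCast _ _).symm
      _ ≤ R ^ (γ * n) := by
        refine Real.rpow_le_rpow_of_exponent_le (h.one_le_r₀.trans hR) ?_
        rw [div_le_iff₀ hγ] at hn
        linarith
      _ = (R ^ γ) ^ n := by rw [Real.rpow_mul hR0.le, Real.rpow_natCast]
      _ ≤ (K * t) ^ n := by gcongr
  have h6 := Real.pow_div_factorial_le_exp (t * δ) (by positivity) n
  rw [Real.exp_neg, inv_mul_le_iff₀ (Real.exp_pos _)]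
  refine h5.trans ?_
  have h7 : (K * t) ^ n = (t * δ) ^ n / n.factorial * (K ^ n * n.factorial / δ ^ n) := by
    rw [mul_pow, mul_pow]
    field_simp
  rw [h7]
  gcongr

/-- On-diagonal upper bound at the scale `R` determined by `t R^d ν(R) ≍ 1`. -/
lemma exists_pt_zero_mul_le (h : IsScalingLevyDensity d ν β M γ r₀ C) {t₀ a : ℝ} (ht₀ : 0 < t₀)
    (hi : Integrable (fun ξ : EuclideanSpace ℝ (Fin d) => Real.exp (-(t₀ * ψ d ν ξ))))
    (ha : 0 < a) :
    ∃ B : ℝ, 0 < B ∧ ∀ t R, t₀ ≤ t → r₀ ≤ R → a ≤ t * (R ^ d * ν R) →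
      pt d ν t 0 * R ^ d ≤ B := by
  have hr₀ : 0 < r₀ := by linarith [h.one_le_r₀]
  have hC : 0 < C := by linarith [h.one_le_C]
  have hγ := h.gamma_pos
  obtain ⟨c, hc, hlow⟩ := h.exists_le_psi
  have hν := h.pos r₀ hr₀
  set δ := c * (r₀ ^ d * ν r₀) with hδ
  have hδ0 : 0 < δ := by positivity
  obtain ⟨B, hB, hB'⟩ := h.exists_exp_neg_mul_pow_le ha hδ0
  set κ := c * a / C with hκ
  have hκ0 : 0 < κ := by positivity
  set I₀ := ∫ ξ : EuclideanSpace ℝ (Fin d), Real.exp (-(t₀ * ψ d ν ξ)) with hI₀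
  set I₁ := ∫ η : EuclideanSpace ℝ (Fin d), Real.exp (-κ * ‖η‖ ^ γ) with hI₁
  have hI₀0 : 0 ≤ I₀ := integral_nonneg fun _ => (Real.exp_pos _).le
  have hI₁0 : 0 ≤ I₁ := integral_nonneg fun _ => (Real.exp_pos _).le
  have hint₁ := integrable_exp_neg_mul_norm_rpow h.dim_pos hκ0 hγ
  set P := ((2 * Real.pi) ^ d)⁻¹ with hP
  have hP0 : 0 < P := by positivity
  refine ⟨P * (Real.exp (t₀ * δ) * I₀ * B + Real.exp κ * I₁) + 1, by positivity,
    fun t R ht hR hat => ?_⟩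
  have hR0 : 0 < R := hr₀.trans_le hR
  have ht0 : 0 < t := ht₀.trans_le ht
  have hpt : ∀ ξ : EuclideanSpace ℝ (Fin d), Real.exp (-(t * ψ d ν ξ)) ≤
      Real.exp (t₀ * δ) * Real.exp (-(t * δ)) * Real.exp (-(t₀ * ψ d ν ξ)) +
      Real.exp κ * Real.exp (-κ * ‖R • ξ‖ ^ γ) := by
    intro ξ
    rw [← Real.exp_add, ← Real.exp_add, ← Real.exp_add, norm_smul, Real.norm_of_nonneg hR0.le]
    have hψ := h.psi_nonneg ξ
    rcases le_total 1 (r₀ * ‖ξ‖) with h1 | h1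
    · have h2 := hlow r₀ hr₀ ξ h1
      have h3 : -(t * ψ d ν ξ) ≤ t₀ * δ + -(t * δ) + -(t₀ * ψ d ν ξ) := by nlinarith
      exact (Real.exp_le_exp.2 h3).trans (le_add_of_nonneg_right (Real.exp_pos _).le)
    refine le_trans (Real.exp_le_exp.2 ?_) (le_add_of_nonneg_left (Real.exp_pos _).le)
    rcases le_total 1 (R * ‖ξ‖) with h2 | h2
    · have hξ : 0 < ‖ξ‖ := by
        by_contra! h0
        rw [le_antisymm h0 (norm_nonneg _)] at h2
        linarith
      have h3 := hlow ‖ξ‖⁻¹ (by positivity) ξ (inv_mul_cancel₀ hξ.ne').ge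
      have hs : r₀ ≤ ‖ξ‖⁻¹ := by
        rw [← one_div, le_div_iff₀ hξ]; exact h1
      have hsR : ‖ξ‖⁻¹ ≤ R := by
        rw [← one_div, div_le_iff₀ hξ]; exact h2
      have h4 := h.pow_mul_upper hs hsR
      have h5 : (‖ξ‖⁻¹ / R) ^ γ = ((R * ‖ξ‖) ^ γ)⁻¹ := by
        rw [← Real.inv_rpow (by positivity)]
        congr 1
        field_simp
      set V := ‖ξ‖⁻¹ ^ d * ν ‖ξ‖⁻¹ with hV
      have hX : 0 < (R * ‖ξ‖) ^ γ := by positivity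
      have h6 : a * (R * ‖ξ‖) ^ γ ≤ C * (t * V) := by
        have h7 := hat.trans (mul_le_mul_of_nonneg_left h4 ht0.le)
        rw [h5] at h7
        have h8 : t * (C * ((R * ‖ξ‖) ^ γ)⁻¹ * V) = C * (t * V) / (R * ‖ξ‖) ^ γ := by
          field_simp
        rwa [h8, le_div_iff₀ hX] at h7
      have h9 : κ * (R * ‖ξ‖) ^ γ ≤ t * ψ d ν ξ := by
        calc κ * (R * ‖ξ‖) ^ γ = c * (a * (R * ‖ξ‖) ^ γ) / C := by rw [hκ]; ring
          _ ≤ c * (C * (t * V)) / C := by gcongr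
          _ = t * (c * V) := by field_simp
          _ ≤ _ := by gcongr
      linarith
    · have h3 : (R * ‖ξ‖) ^ γ ≤ 1 := Real.rpow_le_one (by positivity) h2 hγ.le
      have h4 : 0 ≤ t * ψ d ν ξ := by positivity
      nlinarith
  have hmaj : Integrable (fun ξ : EuclideanSpace ℝ (Fin d) =>
      Real.exp (t₀ * δ) * Real.exp (-(t * δ)) * Real.exp (-(t₀ * ψ d ν ξ)) +
      Real.exp κ * Real.exp (-κ * ‖R • ξ‖ ^ γ)) :=
    (hi.const_mul _).add ((hint₁.comp_smul hR0.ne').const_mul _)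
  have h1 : pt d ν t 0 ≤ P * (Real.exp (t₀ * δ) * Real.exp (-(t * δ)) * I₀ +
      Real.exp κ * ((R ^ d)⁻¹ * I₁)) := by
    refine mul_le_mul_of_nonneg_left ?_ hP0.le
    have h2 := Measure.integral_comp_smul_of_nonneg (volume : Measure (EuclideanSpace ℝ (Fin d)))
      (fun η => Real.exp (-κ * ‖η‖ ^ γ)) R (hR := hR0.le)
    rw [finrank_euclideanSpace_fin, smul_eq_mul] at h2
    rw [← h2, ← integral_const_mul, ← integral_const_mul,
      ← integral_add (hi.const_mul _) ((hint₁.comp_smul hR0.ne').const_mul _)]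
    refine integral_mono_of_nonneg (ae_of_all _ fun ξ => ?_) hmaj (ae_of_all _ fun ξ => ?_)
    · simp only [inner_zero_right, Real.cos_zero, one_mul]
      exact (Real.exp_pos _).le
    · simpa only [inner_zero_right, Real.cos_zero, one_mul] using hpt ξ
  have h2 := hB' t R ht0 hR hat
  calc pt d ν t 0 * R ^ d ≤ P * (Real.exp (t₀ * δ) * Real.exp (-(t * δ)) * I₀ +
        Real.exp κ * ((R ^ d)⁻¹ * I₁)) * R ^ d := by gcongr
    _ = P * (Real.exp (t₀ * δ) * I₀ * (Real.exp (-(t * δ)) * R ^ d) + Real.exp κ * I₁) := by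
      field_simp
    _ ≤ P * (Real.exp (t₀ * δ) * I₀ * B + Real.exp κ * I₁) := by gcongr
    _ ≤ _ := by linarith

end IsScalingLevyDensity

lemma IsUnimodalLevyDensity.integrable_exp_neg_mul_psi {d : ℕ} {ν : ℝ → ℝ} {s t : ℝ}
    (h : IsUnimodalLevyDensity d ν) (hst : s ≤ t)
    (hi : Integrable (fun ξ : EuclideanSpace ℝ (Fin d) => Real.exp (-(s * ψ d ν ξ)))) :
    Integrable (fun ξ : EuclideanSpace ℝ (Fin d) => Real.exp (-(t * ψ d ν ξ))) := by
  have hc := h.continuous_psi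
  refine hi.mono' (by fun_prop) (ae_of_all _ fun ξ => ?_)
  rw [Real.norm_of_nonneg (Real.exp_pos _).le, Real.exp_le_exp, neg_le_neg_iff]
  exact mul_le_mul_of_nonneg_right hst (h.psi_nonneg ξ)

namespace IsScalingLevyDensity

variable {d : ℕ} {ν : ℝ → ℝ} {β M γ r₀ C : ℝ}

lemma exists_pt_le (h : IsScalingLevyDensity d ν β M γ r₀ C) {t₀ a : ℝ} (ht₀ : 0 < t₀)
    (hi : Integrable (fun ξ : EuclideanSpace ℝ (Fin d) => Real.exp (-(t₀ * ψ d ν ξ))))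
    (ha : 0 < a) :
    ∃ A : ℝ, 0 < A ∧ ∀ t R, t₀ ≤ t → r₀ ≤ R → a ≤ t * (R ^ d * ν R) →
      ∀ x : EuclideanSpace ℝ (Fin d), x ≠ 0 → pt d ν t x ≤ A * (t * ν ‖x‖) := by
  obtain ⟨A, hA, hA'⟩ := h.exists_pt_le_of_le_norm
  obtain ⟨B, hB, hB'⟩ := h.exists_pt_zero_mul_le ht₀ hi ha
  refine ⟨A + B / a, by positivity, fun t R ht hR hat x hx => ?_⟩
  have ht0 : 0 < t := ht₀.trans_le ht
  have hR0 : 0 < R := by linarith [h.one_le_r₀]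
  have hx0 : 0 < ‖x‖ := norm_pos_iff.2 hx
  have hνx := h.pos _ hx0
  have hit := h.integrable_exp_neg_mul_psi ht hi
  rcases le_total R ‖x‖ with h1 | h1
  · refine (hA' t ht0.le hit x (hR.trans h1)).trans ?_
    gcongr
    exact le_add_of_nonneg_right (by positivity)
  · have h2 : pt d ν t x ≤ pt d ν t 0 := (h.radDec_pt ht0.le hit).anti 0 x (by simp)
    have h3 := hB' t R ht hR hat
    have h4 := h.anti _ _ hx0 h1
    have h5 : a ≤ t * ν ‖x‖ * R ^ d := by
      calc a ≤ t * (R ^ d * ν R) := hat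
        _ ≤ t * (R ^ d * ν ‖x‖) := by gcongr
        _ = _ := by ring
    have h6 : pt d ν t 0 * R ^ d ≤ B / a * (t * ν ‖x‖) * R ^ d := by
      calc pt d ν t 0 * R ^ d ≤ B / a * a := by rw [div_mul_cancel₀ _ ha.ne']; exact h3
        _ ≤ B / a * (t * ν ‖x‖ * R ^ d) := by gcongr
        _ = _ := by ring
    refine h2.trans ((le_of_mul_le_mul_right h6 (by positivity)).trans ?_)
    gcongr
    exact le_add_of_nonneg_left hA.le

lemma exists_le_one_sub_gaussianMass (h : IsScalingLevyDensity d ν β M γ r₀ C) {b : ℝ}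
    (hb : 0 < b) :
    ∃ c : ℝ, 0 < c ∧ ∀ t r, 0 ≤ t →
      Integrable (fun ξ : EuclideanSpace ℝ (Fin d) => Real.exp (-(t * ψ d ν ξ))) → 0 < r →
      t * (r ^ d * ν r) ≤ b → c * (t * (r ^ d * ν r)) ≤ 1 - gaussianMass d ν t r := by
  obtain ⟨c, hc, hlow⟩ := h.exists_le_psi
  have hvol : 0 < volume.real
      (Metric.ball (0 : EuclideanSpace ℝ (Fin d)) 2 \ Metric.ball 0 (2 / 2)) := by
    have := volume_real_unitBall_pos d
    exact lt_of_lt_of_le (by positivity) (le_volume_real_annulus h.dim_pos two_pos)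
  set S := Metric.ball (0 : EuclideanSpace ℝ (Fin d)) 2 \ Metric.ball 0 (2 / 2) with hS
  have hSm : MeasurableSet S := measurableSet_ball.diff measurableSet_ball
  have hSf : volume S ≠ ⊤ := ((measure_mono Set.sdiff_subset).trans_lt measure_ball_lt_top).ne
  set δ := (4 * Real.pi) ^ (-((d : ℝ) / 2)) * Real.exp (-1) with hδ
  have hδ0 : 0 < δ := by positivity
  refine ⟨c / (1 + c * b) * δ * volume.real S, by positivity, fun t r ht hi hr hrb => ?_⟩
  have hν := h.pos r hr
  set X := t * (r ^ d * ν r) with hX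
  have hX0 : 0 ≤ X := by positivity
  rw [h.one_sub_gaussianMass_eq ht hi hr]
  have hind : ∫ y, S.indicator (fun _ => c / (1 + c * b) * X * δ) y =
      c / (1 + c * b) * δ * volume.real S * X := by
    rw [integral_indicator hSm, setIntegral_const, smul_eq_mul]
    ring
  rw [← hind]
  refine integral_mono ((integrable_indicator_iff hSm).2 (integrableOn_const hSf))
    (h.integrable_one_sub_exp_mul_gaussianWeight ht r) fun η => ?_
  by_cases hη : η ∈ S
  · rw [Set.indicator_of_mem hη]
    have hη1 : ‖η‖ < 2 := by simpa using hη.1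
    have hη2 : 1 ≤ ‖η‖ := by simpa using hη.2
    have h1 : δ ≤ gaussianWeight d η := by
      unfold gaussianWeight
      refine mul_le_mul_of_nonneg_left (Real.exp_le_exp.2 ?_) (by positivity)
      nlinarith
    have h2 : c * X ≤ t * ψ d ν (r⁻¹ • η) := by
      have h3 := hlow r hr (r⁻¹ • η) (by
        rw [norm_smul, Real.norm_of_nonneg (by positivity), mul_inv_cancel_left₀ hr.ne']
        exact hη2)
      calc c * X = t * (c * (r ^ d * ν r)) := by rw [hX]; ring
        _ ≤ _ := by gcongr
    have h4 : c / (1 + c * b) * X ≤ 1 - Real.exp (-(t * ψ d ν (r⁻¹ • η))) := by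
      have h5 : Real.exp (-(t * ψ d ν (r⁻¹ • η))) ≤ (1 + c * X)⁻¹ := by
        rw [Real.exp_neg]
        refine inv_anti₀ (by positivity) ?_
        linarith [Real.add_one_le_exp (t * ψ d ν (r⁻¹ • η))]
      have h6 : c / (1 + c * b) * X ≤ c / (1 + c * X) * X := by gcongr
      have h7 : c / (1 + c * X) * X = 1 - (1 + c * X)⁻¹ := by
        field_simp
        ring
      linarith
    have h8 : 0 ≤ 1 - Real.exp (-(t * ψ d ν (r⁻¹ • η))) := le_trans (by positivity) h4
    exact mul_le_mul h4 h1 hδ0.le h8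
  · rw [Set.indicator_of_notMem hη]
    exact h.one_sub_exp_mul_gaussianWeight_nonneg ht r η

/-- Splitting the Gaussian test integral at radius `s = ‖x‖`. -/
lemma gaussianMass_sub_le (h : IsScalingLevyDensity d ν β M γ r₀ C) {t A : ℝ} (ht : 0 ≤ t)
    (hi : Integrable (fun ξ : EuclideanSpace ℝ (Fin d) => Real.exp (-(t * ψ d ν ξ))))
    (hA : 0 ≤ A) (hup : ∀ y : EuclideanSpace ℝ (Fin d), y ≠ 0 → pt d ν t y ≤ A * (t * ν ‖y‖))
    {r ρ : ℝ} (hr : 0 < r) (hρ : 0 < ρ) {x : EuclideanSpace ℝ (Fin d)} (hx : x ≠ 0) :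
    gaussianMass d ν t ρ - gaussianMass d ν t r ≤
      A * t * (‖x‖ / r) ^ 2 * hfun d ν ‖x‖ + pt d ν t x * (ρ ^ d *
        ∫ y : EuclideanSpace ℝ (Fin d), Real.exp (-1 * ‖y‖ ^ 2)) := by
  have hrd := h.radDec_pt ht hi
  have hx0 : 0 < ‖x‖ := norm_pos_iff.2 hx
  have hg : ∀ {r : ℝ}, 0 < r → Integrable (fun x : EuclideanSpace ℝ (Fin d) =>
      Real.exp (-r⁻¹ ^ 2 * ‖x‖ ^ 2)) := fun hr => integrable_exp_neg_mul_norm_sq (by positivity)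
  have hG : ∫ y : EuclideanSpace ℝ (Fin d), Real.exp (-ρ⁻¹ ^ 2 * ‖y‖ ^ 2) =
      ρ ^ d * ∫ y : EuclideanSpace ℝ (Fin d), Real.exp (-1 * ‖y‖ ^ 2) := by
    have h2 := Measure.integral_comp_inv_smul_of_nonneg
      (volume : Measure (EuclideanSpace ℝ (Fin d)))
      (fun η => Real.exp (-1 * ‖η‖ ^ 2)) hρ.le
    rw [finrank_euclideanSpace_fin, smul_eq_mul] at h2
    rw [← h2]
    congr 1
    ext y
    rw [norm_smul, Real.norm_of_nonneg (by positivity)]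
    ring_nf
  rw [h.gaussianMass_sub_eq ht hi hr hρ, ← hG, hfun, ← integral_const_mul, ← integral_const_mul,
    ← integral_add ((h.integrable_min_div hx0).const_mul _) ((hg hρ).const_mul _)]
  refine integral_mono_ae (h.integrable_pt_mul ht hi ((hg hρ).sub (hg hr)))
    (((h.integrable_min_div hx0).const_mul _).add ((hg hρ).const_mul _)) ?_
  filter_upwards [h.ae_ne_zero] with y hy
  have hy0 : 0 < ‖y‖ := norm_pos_iff.2 hy
  have hνy := h.pos _ hy0
  have hmin : 0 ≤ min (‖y‖ ^ 2 / ‖x‖ ^ 2) 1 := le_min (by positivity) zero_le_one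
  rcases lt_or_ge ‖y‖ ‖x‖ with hyx | hyx
  · refine le_trans ?_ (le_add_of_nonneg_right (mul_nonneg (hrd.nonneg x) (Real.exp_pos _).le))
    have h1 : Real.exp (-ρ⁻¹ ^ 2 * ‖y‖ ^ 2) ≤ 1 := by
      rw [Real.exp_le_one_iff, neg_mul, neg_nonpos]
      positivity
    have h2 := Real.add_one_le_exp (-r⁻¹ ^ 2 * ‖y‖ ^ 2)
    have h3 : (‖x‖ / r) ^ 2 * min (‖y‖ ^ 2 / ‖x‖ ^ 2) 1 = r⁻¹ ^ 2 * ‖y‖ ^ 2 := by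
      rw [min_eq_left]
      · field_simp
      · rw [div_le_one (by positivity)]
        gcongr
    have h4 : Real.exp (-ρ⁻¹ ^ 2 * ‖y‖ ^ 2) - Real.exp (-r⁻¹ ^ 2 * ‖y‖ ^ 2) ≤
        (‖x‖ / r) ^ 2 * min (‖y‖ ^ 2 / ‖x‖ ^ 2) 1 := by
      rw [h3]; linarith
    calc _ ≤ pt d ν t y * ((‖x‖ / r) ^ 2 * min (‖y‖ ^ 2 / ‖x‖ ^ 2) 1) :=
          mul_le_mul_of_nonneg_left h4 (hrd.nonneg y)
      _ ≤ A * (t * ν ‖y‖) * ((‖x‖ / r) ^ 2 * min (‖y‖ ^ 2 / ‖x‖ ^ 2) 1) :=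
          mul_le_mul_of_nonneg_right (hup y hy) (by positivity)
      _ = _ := by ring
  · refine le_trans ?_ (le_add_of_nonneg_left (by positivity))
    have h1 := hrd.anti x y hyx
    have h2 : Real.exp (-ρ⁻¹ ^ 2 * ‖y‖ ^ 2) - Real.exp (-r⁻¹ ^ 2 * ‖y‖ ^ 2) ≤
        Real.exp (-ρ⁻¹ ^ 2 * ‖y‖ ^ 2) := sub_le_self _ (Real.exp_pos _).le
    exact (mul_le_mul_of_nonneg_left h2 (hrd.nonneg y)).trans
      (mul_le_mul_of_nonneg_right h1 (Real.exp_pos _).le)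

/-- Tail lower bound for the heat kernel on spheres of radius `θ r`. -/
lemma exists_le_pt_of_norm_eq (h : IsScalingLevyDensity d ν β M γ r₀ C) {t₀ a b : ℝ}
    (ht₀ : 0 < t₀)
    (hi : Integrable (fun ξ : EuclideanSpace ℝ (Fin d) => Real.exp (-(t₀ * ψ d ν ξ))))
    (ha : 0 < a) (hb : 0 < b) :
    ∃ θ c : ℝ, 0 < θ ∧ θ ≤ 1 ∧ 0 < c ∧ ∀ t R, t₀ ≤ t → r₀ ≤ θ * R →
      a ≤ t * (R ^ d * ν R) → t * (R ^ d * ν R) ≤ b → ∀ r, R ≤ r →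
      ∀ x : EuclideanSpace ℝ (Fin d), ‖x‖ = θ * r → c * (t * ν r) ≤ pt d ν t x := by
  have hr₀ : 0 < r₀ := by linarith [h.one_le_r₀]
  have hC : 0 < C := by linarith [h.one_le_C]
  have hM : 0 < M := by linarith [h.one_le_M]
  have hγ := h.gamma_pos
  have hβ := h.beta_lt
  obtain ⟨A, hA, hup⟩ := h.exists_pt_le ht₀ hi ha
  obtain ⟨A₁, hA₁, htail⟩ := h.exists_one_sub_gaussianMass_le
  obtain ⟨A₂, hA₂, hh⟩ := h.exists_hfun_le
  obtain ⟨c, hc, hlow⟩ := h.exists_le_one_sub_gaussianMass (b := C * b) (by positivity)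
  have hβ' : 0 < 2 - β := by linarith
  set L := 2 * A₁ * C / c + 1 with hL
  have hL1 : 1 ≤ L := by rw [hL]; exact le_add_of_nonneg_left (by positivity)
  set Λ := L ^ γ⁻¹ with hΛ
  have hΛ1 : 1 ≤ Λ := Real.one_le_rpow hL1 (by positivity)
  have hΛ0 : 0 < Λ := by positivity
  have hΛγ : Λ ^ γ = L := Real.rpow_inv_rpow (by positivity) hγ.ne'
  set Q := 4 * A * A₂ * M / c + 1 with hQ
  have hQ1 : 1 ≤ Q := by rw [hQ]; exact le_add_of_nonneg_left (by positivity)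
  set θ := Q⁻¹ ^ (2 - β)⁻¹ with hθ
  have hθ0 : 0 < θ := by positivity
  have hθ1 : θ ≤ 1 := Real.rpow_le_one (by positivity) (inv_le_one_of_one_le₀ hQ1) (by positivity)
  have hθβ : θ ^ (2 - β) = Q⁻¹ := Real.rpow_inv_rpow (by positivity) hβ'.ne'
  set G := ∫ y : EuclideanSpace ℝ (Fin d), Real.exp (-1 * ‖y‖ ^ 2) with hG
  have hG0 : 0 < G := by
    rw [hG, GaussianFourier.integral_rexp_neg_mul_sq_norm one_pos]
    positivity
  refine ⟨θ, c / 4 / (Λ ^ d * G), hθ0, hθ1, by positivity,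
    fun t R ht hR hat htb r hr x hx => ?_⟩
  have ht0 : 0 < t := ht₀.trans_le ht
  have hit := h.integrable_exp_neg_mul_psi ht hi
  have hR0 : 0 < R := by
    by_contra! h0
    nlinarith
  have hr0 : 0 < r := hR0.trans_le hr
  have hRr₀ : r₀ ≤ R := hR.trans (mul_le_of_le_one_left hR0.le hθ1)
  have hνr := h.pos r hr0
  have hνR := h.pos R hR0
  have hs0 : 0 < θ * r := by positivity
  have hs : r₀ ≤ θ * r := hR.trans (by gcongr)
  have hx0 : x ≠ 0 := norm_pos_iff.1 (by rw [hx]; exact hs0)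
  set V := r ^ d * ν r with hV
  have hV0 : 0 < V := by positivity
  have hVb : t * V ≤ C * b := by
    have h1 := h.pow_mul_upper hRr₀ hr
    have h2 : (R / r) ^ γ ≤ 1 :=
      Real.rpow_le_one (by positivity) ((div_le_one hr0).2 hr) hγ.le
    calc t * V ≤ t * (C * (R / r) ^ γ * (R ^ d * ν R)) := by gcongr
      _ ≤ t * (C * 1 * (R ^ d * ν R)) := by gcongr
      _ = C * (t * (R ^ d * ν R)) := by ring
      _ ≤ C * b := by gcongr
  have hlower := hlow t r ht0.le hit hr0 hVb
  have hupper : 1 - gaussianMass d ν t (Λ * r) ≤ c / 2 * (t * V) := by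
    have hrΛ : r ≤ Λ * r := le_mul_of_one_le_left hr0.le hΛ1
    have h1 := htail t (Λ * r) ht0.le hit (hRr₀.trans (hr.trans hrΛ))
    have h2 := h.pow_mul_upper (hRr₀.trans hr) hrΛ
    have h3 : (r / (Λ * r)) ^ γ = L⁻¹ := by
      rw [← hΛγ, ← Real.inv_rpow hΛ0.le]
      congr 1
      field_simp
    rw [h3] at h2
    have h4 : A₁ * C * L⁻¹ ≤ c / 2 := by
      rw [mul_inv_le_iff₀ (by positivity), hL]
      have : c / 2 * (2 * A₁ * C / c + 1) = A₁ * C + c / 2 := by field_simp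
      linarith
    calc _ ≤ A₁ * (t * ((Λ * r) ^ d * ν (Λ * r))) := h1
      _ ≤ A₁ * (t * (C * L⁻¹ * V)) := by gcongr
      _ = A₁ * C * L⁻¹ * (t * V) := by ring
      _ ≤ _ := by gcongr
  have hsplit := h.gaussianMass_sub_le ht0.le hit hA.le (hup t R ht hRr₀ hat) hr0
    (by positivity : 0 < Λ * r) hx0
  have hsmall : A * t * (‖x‖ / r) ^ 2 * hfun d ν ‖x‖ ≤ c / 4 * (t * V) := by
    rw [hx, mul_div_assoc, div_self hr0.ne', mul_one]
    have h1 := hh (θ * r) hs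
    have h2 := h.pow_mul_lower hs0 (mul_le_of_le_one_left hr0.le hθ1)
    have h3 : (r / (θ * r)) ^ β = (θ ^ β)⁻¹ := by
      rw [← Real.inv_rpow hθ0.le]
      congr 1
      field_simp
    rw [h3] at h2
    have h4 : θ ^ 2 * (θ ^ β)⁻¹ = Q⁻¹ := by
      rw [← hθβ, Real.rpow_sub hθ0, Real.rpow_two, div_eq_mul_inv]
    have h5 : A * A₂ * M * Q⁻¹ ≤ c / 4 := by
      rw [mul_inv_le_iff₀ (by positivity), hQ]
      have : c / 4 * (4 * A * A₂ * M / c + 1) = A * A₂ * M + c / 4 := by field_simp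
      linarith
    calc A * t * θ ^ 2 * hfun d ν (θ * r)
        ≤ A * t * θ ^ 2 * (A₂ * (M * (θ ^ β)⁻¹ * V)) := by
          gcongr
          exact h1.trans (mul_le_mul_of_nonneg_left h2 hA₂.le)
      _ = A * A₂ * M * (θ ^ 2 * (θ ^ β)⁻¹) * (t * V) := by ring
      _ ≤ c / 4 * (t * V) := by rw [h4]; gcongr
  have h6 : c / 4 * (t * V) ≤ pt d ν t x * ((Λ * r) ^ d * G) := by linarith
  have h7 : c / 4 * (t * ν r) * r ^ d ≤ pt d ν t x * (Λ ^ d * G) * r ^ d := by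
    calc _ = c / 4 * (t * V) := by rw [hV]; ring
      _ ≤ _ := h6
      _ = _ := by rw [mul_pow]; ring
  have h8 := le_of_mul_le_mul_right h7 (by positivity)
  rw [div_mul_eq_mul_div, div_le_iff₀ (by positivity)]
  exact h8

lemma exists_min_le_pt (h : IsScalingLevyDensity d ν β M γ r₀ C) {t₀ a b : ℝ} (ht₀ : 0 < t₀)
    (hi : Integrable (fun ξ : EuclideanSpace ℝ (Fin d) => Real.exp (-(t₀ * ψ d ν ξ))))
    (ha : 0 < a) (hb : 0 < b) :
    ∃ R₁ c : ℝ, r₀ ≤ R₁ ∧ 0 < c ∧ ∀ t R, t₀ ≤ t → R₁ ≤ R →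
      a ≤ t * (R ^ d * ν R) → t * (R ^ d * ν R) ≤ b → c ≤ pt d ν t 0 * R ^ d ∧
      ∀ x : EuclideanSpace ℝ (Fin d), x ≠ 0 →
        c * min (pt d ν t 0) (t * ν ‖x‖) ≤ pt d ν t x := by
  obtain ⟨B, hB, hB'⟩ := h.exists_pt_zero_mul_le ht₀ hi ha
  obtain ⟨θ, c, hθ0, hθ1, hc, hlow⟩ := h.exists_le_pt_of_norm_eq ht₀ hi ha hb
  have hr₀ : 0 < r₀ := by linarith [h.one_le_r₀]
  have hM : 0 < M := by linarith [h.one_le_M]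
  set N := M * θ⁻¹ ^ ((d : ℝ) + β) with hN
  have hN0 : 0 < N := by positivity
  set c' := min (c * a) (min (c * a / B) (c / N)) with hc'
  have hc'0 : 0 < c' := by positivity
  refine ⟨r₀ / θ, c', ?_, hc'0, fun t R ht hR hat htb => ?_⟩
  · rw [le_div_iff₀ hθ0]
    exact mul_le_of_le_one_right hr₀.le hθ1
  have ht0 : 0 < t := ht₀.trans_le ht
  have hit := h.integrable_exp_neg_mul_psi ht hi
  have hrd := h.radDec_pt ht0.le hit
  have hRθ : r₀ ≤ θ * R := by
    rw [div_le_iff₀ hθ0] at hR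
    linarith
  have hR0 : 0 < R := lt_of_lt_of_le (by positivity) hR
  have hRr₀ : r₀ ≤ R := hRθ.trans (mul_le_of_le_one_left hR0.le hθ1)
  obtain ⟨y, hy⟩ := h.exists_norm_eq (by positivity : 0 ≤ θ * R)
  have h1 : c * a ≤ pt d ν t y * R ^ d := by
    have h2 := hlow t R ht hRθ hat htb R le_rfl y hy
    calc c * a ≤ c * (t * (R ^ d * ν R)) := by gcongr
      _ = c * (t * ν R) * R ^ d := by ring
      _ ≤ _ := by gcongr
  refine ⟨(min_le_left _ _).trans (h1.trans ?_), fun x hx => ?_⟩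
  · have := hrd.anti 0 y (by simp)
    gcongr
  have hx0 : 0 < ‖x‖ := norm_pos_iff.2 hx
  have hνx := h.pos _ hx0
  have hmin0 : 0 ≤ min (pt d ν t 0) (t * ν ‖x‖) := le_min (hrd.nonneg 0) (by positivity)
  rcases le_total (θ * R) ‖x‖ with hxR | hxR
  · have h2 : R ≤ ‖x‖ / θ := by
      rw [le_div_iff₀ hθ0]; linarith
    have h3 := hlow t R ht hRθ hat htb (‖x‖ / θ) h2 x (by field_simp)
    have h4 := h.lower ‖x‖ (‖x‖ / θ) hx0 (by
      rw [le_div_iff₀ hθ0]; exact mul_le_of_le_one_right hx0.le hθ1)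
    have h5 : ‖x‖ / θ / ‖x‖ = θ⁻¹ := by field_simp
    rw [h5, ← hN] at h4
    calc c' * min (pt d ν t 0) (t * ν ‖x‖) ≤ c / N * (t * ν ‖x‖) :=
          mul_le_mul ((min_le_right _ _).trans (min_le_right _ _)) (min_le_right _ _) hmin0
            (by positivity)
      _ ≤ c / N * (t * (N * ν (‖x‖ / θ))) := by gcongr
      _ = c * (t * ν (‖x‖ / θ)) := by field_simp
      _ ≤ _ := h3
  · have h2 := hrd.anti x y (by rw [hy]; exact hxR)
    have h3 := hB' t R ht hRr₀ hat
    have h4 : c * a / B * pt d ν t 0 * R ^ d ≤ pt d ν t y * R ^ d := by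
      calc _ = c * a / B * (pt d ν t 0 * R ^ d) := by ring
        _ ≤ c * a / B * B := by gcongr
        _ = c * a := by field_simp
        _ ≤ _ := h1
    calc c' * min (pt d ν t 0) (t * ν ‖x‖) ≤ c * a / B * pt d ν t 0 :=
          mul_le_mul ((min_le_right _ _).trans (min_le_left _ _)) (min_le_left _ _) hmin0
            (by positivity)
      _ ≤ pt d ν t y := le_of_mul_le_mul_right h4 (by positivity)
      _ ≤ _ := h2

end IsScalingLevyDensity

lemma isScalingLevyDensity_of_tendsto {d : ℕ} {ν : ℝ → ℝ} {β M α : ℝ}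
    (h : IsUnimodalLevyDensity d ν) (hβ : β ∈ Set.Ioo (0 : ℝ) 2) (hM : 1 < M)
    (hA1 : ∀ r₁ r₂ : ℝ, 0 < r₁ → r₁ < r₂ → ν r₁ ≤ M * (r₂ / r₁) ^ ((d : ℝ) + β) * ν r₂)
    (hα : 0 < α)
    (hlim : Tendsto (fun r : ℝ => ν (2 * r) / ν r) atTop (nhds ((2 : ℝ) ^ (-(d : ℝ) - α)))) :
    ∃ r₀ C : ℝ, IsScalingLevyDensity d ν β M (α / 2) r₀ C := by
  obtain ⟨r₀, hr₀, hup⟩ := exists_upper_scaling_of_tendsto (p := (d : ℝ) + α)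
    (q := (d : ℝ) + α / 2) h.pos h.anti (by positivity) (by linarith)
    (by rwa [neg_add, ← sub_eq_add_neg])
  refine ⟨r₀, 2 ^ ((d : ℝ) + α / 2), ?_⟩
  exact
    { toIsUnimodalLevyDensity := h
      beta_pos := hβ.1
      beta_lt := hβ.2
      one_le_M := hM.le
      gamma_pos := by linarith
      one_le_r₀ := hr₀
      one_le_C := Real.one_le_rpow one_le_two (by positivity)
      lower := fun s r hs hsr => by
        rcases hsr.eq_or_lt with rfl | hlt
        · rw [div_self hs.ne', Real.one_rpow, mul_one]
          exact le_mul_of_one_le_left (h.pos s hs).le hM.le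
        · exact hA1 s r hs hlt
      upper := hup }

theorem statement16
    (d : ℕ) (hd : 1 ≤ d) (ν : ℝ → ℝ)
    (hν_pos : ∀ r : ℝ, 0 < r → 0 < ν r)
    (hν_mono : ∀ r₁ r₂ : ℝ, 0 < r₁ → r₁ ≤ r₂ → ν r₂ ≤ ν r₁)
    (hint : Integrable (fun z : EuclideanSpace ℝ (Fin d) => min (‖z‖ ^ 2) 1 * ν ‖z‖))
    (hninf : ¬ Integrable (fun z : EuclideanSpace ℝ (Fin d) => ν ‖z‖))
    (β M : ℝ) (hβ : β ∈ Set.Ioo (0:ℝ) 2) (hM : 1 < M)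
    (hA1 : ∀ r₁ r₂ : ℝ, 0 < r₁ → r₁ < r₂ → ν r₁ ≤ M * (r₂ / r₁) ^ ((d:ℝ) + β) * ν r₂)
    (α : ℝ) (hα : α ∈ Set.Ioo (0:ℝ) 2)
    (hA2 : ∀ lam : ℝ, 0 < lam →
      Tendsto (fun r : ℝ => ν (lam * r) / ν r) atTop (nhds (lam ^ (-(d:ℝ) - α))))
    (t₀ : ℝ) (ht₀ : 0 < t₀)
    (hA3 : Integrable (fun ξ : EuclideanSpace ℝ (Fin d) => Real.exp (-(t₀ * ψ d ν ξ))))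
    (hnorm : ∀ ξ : EuclideanSpace ℝ (Fin d), ‖ξ‖ = 1 → ψ d ν ξ = 1)
:
    ∃ T₁ C : ℝ, t₀ ≤ T₁ ∧ 1 ≤ C ∧ ∀ t : ℝ, T₁ ≤ t →
      (C⁻¹ * ψinv d ν (1 / t) ^ d ≤ pt d ν t 0 ∧
        pt d ν t 0 ≤ C * ψinv d ν (1 / t) ^ d) ∧
      ∀ x : EuclideanSpace ℝ (Fin d), x ≠ 0 →
        C⁻¹ * min (pt d ν t 0) (t * ν ‖x‖) ≤ pt d ν t x ∧
          pt d ν t x ≤ C * min (pt d ν t 0) (t * ν ‖x‖) := by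
  have hU : IsUnimodalLevyDensity d ν := ⟨hd, hν_pos, hν_mono, hint⟩
  obtain ⟨r₀, C₀, h⟩ := isScalingLevyDensity_of_tendsto hU hβ hM hA1 hα.1 (hA2 2 two_pos)
  obtain ⟨a, b, ha, hb, hscale⟩ := h.exists_scale
  obtain ⟨A, hA, hup⟩ := h.exists_pt_le ht₀ hA3 ha
  obtain ⟨B, hB, hdiag⟩ := h.exists_pt_zero_mul_le ht₀ hA3 ha
  obtain ⟨R₁, c, hR₁, hc, hlow⟩ := h.exists_min_le_pt ht₀ hA3 ha hb
  obtain ⟨T, -, hTscale⟩ := hscale R₁ hR₁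
  have hc0 : 0 < c⁻¹ := inv_pos.2 hc
  have hC0 : 0 < 1 + A + B + c⁻¹ := by positivity
  have hCc : (1 + A + B + c⁻¹)⁻¹ ≤ c := by
    rw [inv_le_comm₀ hC0 hc]
    linarith
  refine ⟨max t₀ T, 1 + A + B + c⁻¹, le_max_left _ _, by linarith, fun t ht => ?_⟩
  have htt₀ : t₀ ≤ t := (le_max_left _ _).trans ht
  have ht0 : 0 < t := ht₀.trans_le htt₀
  obtain ⟨R, hR, hinv, hat, htb⟩ := hTscale t ((le_max_right _ _).trans ht)
  have hRr₀ : r₀ ≤ R := hR₁.trans hR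
  have hR0 : 0 < R := by linarith [h.one_le_r₀]
  have hrd := h.radDec_pt ht0.le (h.integrable_exp_neg_mul_psi htt₀ hA3)
  obtain ⟨hlow0, hlowx⟩ := hlow t R htt₀ hR hat htb
  refine ⟨?_, fun x hx => ?_⟩
  · rw [hinv, inv_pow, ← div_eq_mul_inv, ← div_eq_mul_inv, div_le_iff₀ (by positivity),
      le_div_iff₀ (by positivity)]
    exact ⟨hCc.trans hlow0, (hdiag t R htt₀ hRr₀ hat).trans (by linarith)⟩
  · have hν := hν_pos _ (norm_pos_iff.2 hx)
    have h0 := hrd.nonneg 0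
    refine ⟨le_trans (mul_le_mul_of_nonneg_right hCc (le_min h0 (by positivity))) (hlowx x hx), ?_⟩
    rw [mul_min_of_nonneg _ _ hC0.le]
    refine le_min ((hrd.anti 0 x (by simp)).trans (le_mul_of_one_le_left h0 (by linarith))) ?_
    refine (hup t R htt₀ hRr₀ hat x hx).trans (mul_le_mul_of_nonneg_right ?_ (by positivity))
    linarith

end
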